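/- arXiv:1209.1534 — 3 statements merged into one kernel-verified Lean document; each statement's English description precedes it below -/
import Mathlib

section
/- There exists a constant C > 0, independent of p, such that for all sufficiently large p > 1 one has p·∫_B |∇u_p|² dx ≤ C (equivalently, p·∫_B |u_p|^{p+1} dx ≤ C). -/
open Real MeasureTheory Set Filter

noncomputable section

/-- The radial energy functional for the Lane–Emden problem on the unit ball of `ℝ²`
(written in polar coordinates; the common factor `2π` is dropped). -/
def radialEnergy (p : ℝ) (v : ℝ → ℝ) : ℝ :=
  (1 / 2) * (∫ r in (0:ℝ)..1, (deriv v r) ^ 2 * r)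
    - (1 / (p + 1)) * ∫ r in (0:ℝ)..1, |v r| ^ (p + 1) * r

/-- The Nehari identity `∫_B |∇v⁺|² = ∫_B |v⁺|^{p+1}` for the positive part,
written in polar coordinates. -/
def nehariPos (p : ℝ) (v : ℝ → ℝ) : Prop :=
  (∫ r in (0:ℝ)..1, (if 0 < v r then (deriv v r) ^ 2 * r else 0))
    = ∫ r in (0:ℝ)..1, (max (v r) 0) ^ (p + 1) * r

/-- The Nehari identity `∫_B |∇v⁻|² = ∫_B |v⁻|^{p+1}` for the negative part,
written in polar coordinates. -/
def nehariNeg (p : ℝ) (v : ℝ → ℝ) : Prop :=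
  (∫ r in (0:ℝ)..1, (if v r < 0 then (deriv v r) ^ 2 * r else 0))
    = ∫ r in (0:ℝ)..1, (max (-v r) 0) ^ (p + 1) * r

/-- A family `p ↦ u p` (for `p > 1`) of least energy nodal radial solutions of the
Lane–Emden problem `−Δu = |u|^{p−1}u` in the unit ball `B ⊆ ℝ²`, `u = 0` on `∂B`,
described through the radial profile `u p : ℝ → ℝ`.  `rp p ∈ (0,1)` is the nodal
radius, `sp p ∈ (rp p, 1)` is a radius where `u p` attains `‖(u p)⁺‖_∞`; the solution
is negative in the inner nodal region (`u p 0 < 0`), attains `-‖(u p)⁻‖_∞` at `0`,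
and minimizes the energy among radial members of the nodal Nehari set. -/
structure LaneEmdenFamily where
  u : ℝ → ℝ → ℝ
  rp : ℝ → ℝ
  sp : ℝ → ℝ
  smooth : ∀ p, 1 < p → ContDiffOn ℝ 2 (u p) (Icc (0:ℝ) 1)
  ode : ∀ p, 1 < p → ∀ r ∈ Ioo (0:ℝ) 1,
    -deriv (deriv (u p)) r - deriv (u p) r / r = |u p r| ^ (p - 1) * u p r
  derivAtZero : ∀ p, 1 < p → deriv (u p) 0 = 0
  boundary : ∀ p, 1 < p → u p 1 = 0
  center_neg : ∀ p, 1 < p → u p 0 < 0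
  min_at_zero : ∀ p, 1 < p → ∀ r ∈ Icc (0:ℝ) 1, u p 0 ≤ u p r
  rp_mem : ∀ p, 1 < p → rp p ∈ Ioo (0:ℝ) 1
  rp_zero : ∀ p, 1 < p → u p (rp p) = 0
  neg_in : ∀ p, 1 < p → ∀ r ∈ Ico (0:ℝ) (rp p), u p r < 0
  pos_out : ∀ p, 1 < p → ∀ r ∈ Ioo (rp p) 1, 0 < u p r
  sp_mem : ∀ p, 1 < p → sp p ∈ Ioo (rp p) 1
  sp_max : ∀ p, 1 < p → ∀ r ∈ Icc (0:ℝ) 1, u p r ≤ u p (sp p)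
  least_energy : ∀ p, 1 < p → ∀ v : ℝ → ℝ,
    ContDiffOn ℝ 1 v (Icc (0:ℝ) 1) → v 1 = 0 →
    (∃ r ∈ Ioo (0:ℝ) 1, 0 < v r) → (∃ r ∈ Ioo (0:ℝ) 1, v r < 0) →
    nehariPos p v → nehariNeg p v →
    radialEnergy p (u p) ≤ radialEnergy p v

/-- `ε_p⁺`, defined by `(ε_p⁺)⁻² = p · ‖u_p⁺‖_∞^{p−1} = p · u_p(s_p)^{p−1}`. -/
def epsP (F : LaneEmdenFamily) (p : ℝ) : ℝ :=
  1 / Real.sqrt (p * F.u p (F.sp p) ^ (p - 1))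

/-- `ε_p⁻`, defined by `(ε_p⁻)⁻² = p · ‖u_p⁻‖_∞^{p−1} = p · |u_p(0)|^{p−1}`. -/
def epsM (F : LaneEmdenFamily) (p : ℝ) : ℝ :=
  1 / Real.sqrt (p * (-F.u p 0) ^ (p - 1))

/-- A radial `C²` solution of the Lane–Emden equation vanishing at `1` satisfies the
Nehari identity. -/
lemma integral_deriv_sq_eq_of_ode {p : ℝ} (hp : 1 < p) {u : ℝ → ℝ}
    (hu : ContDiffOn ℝ 2 u (Icc (0:ℝ) 1))
    (hode : ∀ r ∈ Ioo (0:ℝ) 1, -deriv (deriv u) r - deriv u r / r = |u r| ^ (p - 1) * u r)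
    (hu1 : u 1 = 0) :
    ∫ r in (0:ℝ)..1, (deriv u r) ^ 2 * r = ∫ r in (0:ℝ)..1, |u r| ^ (p + 1) * r := by
  set w := derivWithin u (Icc (0:ℝ) 1) with hw
  have hwC : ContDiffOn ℝ 1 w (Icc (0:ℝ) 1) :=
    hu.derivWithin (uniqueDiffOn_Icc zero_lt_one) (by norm_num)
  have hwd : ∀ r ∈ Ioo (0:ℝ) 1, w r = deriv u r := fun r hr =>
    derivWithin_of_mem_nhds (Icc_mem_nhds hr.1 hr.2)
  have huc : ContinuousOn u (Icc (0:ℝ) 1) := hu.continuousOn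
  have hwc : ContinuousOn w (Icc (0:ℝ) 1) := hwC.continuousOn
  have hpow : ContinuousOn (fun r => |u r| ^ (p + 1) * r) (Icc (0:ℝ) 1) :=
    (huc.abs.rpow_const fun _ _ => Or.inr (by linarith)).mul continuousOn_id
  have hsq : ContinuousOn (fun r => (w r) ^ 2 * r) (Icc (0:ℝ) 1) :=
    (hwc.pow 2).mul continuousOn_id
  have hi1 : IntervalIntegrable (fun r => |u r| ^ (p + 1) * r) volume 0 1 :=
    hpow.intervalIntegrable_of_Icc zero_le_one
  have hi2 : IntervalIntegrable (fun r => (w r) ^ 2 * r) volume 0 1 :=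
    hsq.intervalIntegrable_of_Icc zero_le_one
  have hFTC : ∫ r in (0:ℝ)..1, ((w r) ^ 2 * r - |u r| ^ (p + 1) * r)
      = 1 * w 1 * u 1 - 0 * w 0 * u 0 := by
    refine intervalIntegral.integral_eq_sub_of_hasDerivAt_of_le (f := fun r => r * w r * u r)
      zero_le_one ((continuousOn_id.mul hwc).mul huc) ?_ (hi2.sub hi1)
    intro r hr
    have hnhds := Icc_mem_nhds hr.1 hr.2
    have hud : HasDerivAt u (w r) r := by
      rw [hwd r hr]
      exact ((hu.contDiffAt hnhds).differentiableAt (by norm_num)).hasDerivAt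
    have hwd' : HasDerivAt w (deriv (deriv u) r) r := by
      have heq : w =ᶠ[nhds r] deriv u := by
        filter_upwards [Ioo_mem_nhds hr.1 hr.2] with x hx using hwd x hx
      rw [← heq.deriv_eq]
      exact ((hwC.contDiffAt hnhds).differentiableAt (by norm_num)).hasDerivAt
    have hder := ((hasDerivAt_id r).mul hwd').mul hud
    refine hder.congr_deriv ?_
    have h := hode r hr
    rw [← hwd r hr] at h
    have hr0 : r ≠ 0 := hr.1.ne'
    have hflux : w r + r * deriv (deriv u) r = -(r * (|u r| ^ (p - 1) * u r)) := by
      rw [← h]; field_simp; ring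
    have habs : |u r| ^ (p + 1) = |u r| ^ (p - 1) * u r * u r := by
      rcases eq_or_ne (u r) 0 with h0 | h0
      · rw [h0, abs_zero, Real.zero_rpow (by linarith)]; ring
      · rw [show p + 1 = (p - 1) + 2 by ring, Real.rpow_add (abs_pos.2 h0), Real.rpow_two,
          sq_abs]
        ring
    simp only [id, Pi.mul_apply, one_mul]
    rw [hflux, habs]
    ring
  rw [intervalIntegral.integral_sub hi2 hi1, hu1] at hFTC
  have hcongr : ∫ r in (0:ℝ)..1, (deriv u r) ^ 2 * r = ∫ r in (0:ℝ)..1, (w r) ^ 2 * r := by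
    refine intervalIntegral.integral_congr_ae ?_
    have h1 : ∀ᵐ r : ℝ, r ≠ 1 := by simp [ae_iff]
    filter_upwards [h1] with r hr1 hr
    rw [uIoc_of_le zero_le_one] at hr
    simp only [hwd r ⟨hr.1, lt_of_le_of_ne hr.2 hr1⟩]
  rw [hcongr]
  linarith

/-- A differentiable nonnegative function has zero derivative wherever it vanishes. -/
lemma deriv_eq_zero_of_nonneg_of_eq_zero {φ : ℝ → ℝ} (hφ : ∀ x, 0 ≤ φ x) {r : ℝ}
    (hr : φ r = 0) : deriv φ r = 0 :=
  IsLocalMin.deriv_eq_zero (Eventually.of_forall fun x => hr ▸ hφ x)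

/-- The scaling factor which puts a nonnegative function on the Nehari manifold. -/
def nehariScale (p : ℝ) (φ : ℝ → ℝ) : ℝ :=
  ((∫ r in (0:ℝ)..1, (deriv φ r) ^ 2 * r) / ∫ r in (0:ℝ)..1, (φ r) ^ (p + 1) * r) ^ (1 / (p - 1))

lemma nehariScale_identity {p : ℝ} (hp : 1 < p) {φ : ℝ → ℝ}
    (hA : 0 < ∫ r in (0:ℝ)..1, (deriv φ r) ^ 2 * r)
    (hB : 0 < ∫ r in (0:ℝ)..1, (φ r) ^ (p + 1) * r) :
    nehariScale p φ ^ 2 * (∫ r in (0:ℝ)..1, (deriv φ r) ^ 2 * r)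
      = nehariScale p φ ^ (p + 1) * ∫ r in (0:ℝ)..1, (φ r) ^ (p + 1) * r := by
  have hq := div_pos hA hB
  have hs : 0 < nehariScale p φ := Real.rpow_pos_of_pos hq _
  have h1 : nehariScale p φ ^ (p - 1)
      = (∫ r in (0:ℝ)..1, (deriv φ r) ^ 2 * r) / ∫ r in (0:ℝ)..1, (φ r) ^ (p + 1) * r := by
    rw [nehariScale, ← Real.rpow_mul hq.le, one_div_mul_cancel (by linarith), Real.rpow_one]
  rw [show p + 1 = (p - 1) + 2 by ring, Real.rpow_add hs, Real.rpow_two,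
    show p - 1 + 2 = p + 1 by ring, h1]
  field_simp

lemma deriv_const_mul_sub_const_mul (α β : ℝ) {φ ψ : ℝ → ℝ} (hφ : Differentiable ℝ φ)
    (hψ : Differentiable ℝ ψ) (r : ℝ) :
    deriv (fun r => α * φ r - β * ψ r) r = α * deriv φ r - β * deriv ψ r :=
  (((hφ r).hasDerivAt.const_mul α).sub ((hψ r).hasDerivAt.const_mul β)).deriv

lemma nehariPos_of_disjoint {p α β : ℝ} (hp : 1 < p) (hα : 0 < α) (hβ : 0 < β) {φ ψ : ℝ → ℝ}
    (hφ : Differentiable ℝ φ) (hψ : Differentiable ℝ ψ)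
    (hφ0 : ∀ r, 0 ≤ φ r) (hψ0 : ∀ r, 0 ≤ ψ r) (hdisj : ∀ r, φ r = 0 ∨ ψ r = 0)
    (h : α ^ 2 * (∫ r in (0:ℝ)..1, (deriv φ r) ^ 2 * r)
      = α ^ (p + 1) * ∫ r in (0:ℝ)..1, (φ r) ^ (p + 1) * r) :
    nehariPos p (fun r => α * φ r - β * ψ r) := by
  rw [← intervalIntegral.integral_const_mul, ← intervalIntegral.integral_const_mul] at h
  unfold nehariPos
  refine (intervalIntegral.integral_congr fun r _ => ?_).trans
    (h.trans (intervalIntegral.integral_congr fun r _ => ?_))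
  · beta_reduce
    rw [deriv_const_mul_sub_const_mul α β hφ hψ]
    rcases (hφ0 r).eq_or_lt with h0 | h0
    · have := mul_nonneg hβ.le (hψ0 r)
      rw [if_neg (by rw [← h0]; linarith), deriv_eq_zero_of_nonneg_of_eq_zero hφ0 h0.symm]
      ring
    · have hψr : ψ r = 0 := (hdisj r).resolve_left h0.ne'
      rw [if_pos (by rw [hψr]; simpa using mul_pos hα h0),
        deriv_eq_zero_of_nonneg_of_eq_zero hψ0 hψr]
      ring
  · beta_reduce
    rcases (hφ0 r).eq_or_lt with h0 | h0
    · have := mul_nonneg hβ.le (hψ0 r)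
      rw [max_eq_right (by rw [← h0]; linarith), ← h0, Real.zero_rpow (by linarith)]
      ring
    · have hψr : ψ r = 0 := (hdisj r).resolve_left h0.ne'
      rw [hψr, mul_zero, sub_zero, max_eq_left (mul_pos hα h0).le, Real.mul_rpow hα.le h0.le]
      ring

lemma nehariNeg_of_nehariPos_neg {p : ℝ} {v : ℝ → ℝ} (h : nehariPos p (fun r => -v r)) :
    nehariNeg p v := by
  unfold nehariPos at h
  unfold nehariNeg
  simpa [deriv.fun_neg] using h

/-- The energy of a least energy solution is controlled by any pair of bumps with disjoint
supports. -/
lemma LaneEmdenFamily.radialEnergy_le (F : LaneEmdenFamily) {p : ℝ} (hp : 1 < p) {φ ψ : ℝ → ℝ}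
    (hφ : ContDiff ℝ 1 φ) (hψ : ContDiff ℝ 1 ψ)
    (hφ0 : ∀ r, 0 ≤ φ r) (hψ0 : ∀ r, 0 ≤ ψ r) (hdisj : ∀ r, φ r = 0 ∨ ψ r = 0)
    (hφ1 : φ 1 = 0) (hψ1 : ψ 1 = 0)
    (hφpos : ∃ r ∈ Ioo (0:ℝ) 1, 0 < φ r) (hψpos : ∃ r ∈ Ioo (0:ℝ) 1, 0 < ψ r)
    (hAφ : 0 < ∫ r in (0:ℝ)..1, (deriv φ r) ^ 2 * r)
    (hBφ : 0 < ∫ r in (0:ℝ)..1, (φ r) ^ (p + 1) * r)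
    (hAψ : 0 < ∫ r in (0:ℝ)..1, (deriv ψ r) ^ 2 * r)
    (hBψ : 0 < ∫ r in (0:ℝ)..1, (ψ r) ^ (p + 1) * r) :
    radialEnergy p (F.u p) ≤
      (1 / 2) * (nehariScale p φ ^ 2 * (∫ r in (0:ℝ)..1, (deriv φ r) ^ 2 * r)
        + nehariScale p ψ ^ 2 * (∫ r in (0:ℝ)..1, (deriv ψ r) ^ 2 * r)) := by
  have hα : 0 < nehariScale p φ := Real.rpow_pos_of_pos (div_pos hAφ hBφ) _
  have hβ : 0 < nehariScale p ψ := Real.rpow_pos_of_pos (div_pos hAψ hBψ) _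
  have hNα := nehariScale_identity hp hAφ hBφ
  have hNβ := nehariScale_identity hp hAψ hBψ
  set α := nehariScale p φ
  set β := nehariScale p ψ
  have hφd : Differentiable ℝ φ := hφ.differentiable one_ne_zero
  have hψd : Differentiable ℝ ψ := hψ.differentiable one_ne_zero
  have hneg : nehariNeg p (fun r => α * φ r - β * ψ r) := by
    refine nehariNeg_of_nehariPos_neg ?_
    simp only [neg_sub]
    exact nehariPos_of_disjoint hp hβ hα hψd hφd hψ0 hφ0 (fun r => (hdisj r).symm) hNβ
  have hle := F.least_energy p hp (fun r => α * φ r - β * ψ r)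
    ((contDiff_const.mul hφ).sub (contDiff_const.mul hψ)).contDiffOn (by simp [hφ1, hψ1])
    (by
      obtain ⟨r, hr, h⟩ := hφpos
      refine ⟨r, hr, ?_⟩
      rw [(hdisj r).resolve_left h.ne', mul_zero, sub_zero]
      exact mul_pos hα h)
    (by
      obtain ⟨r, hr, h⟩ := hψpos
      refine ⟨r, hr, ?_⟩
      rw [(hdisj r).resolve_right h.ne', mul_zero, zero_sub, neg_lt_zero]
      exact mul_pos hβ h)
    (nehariPos_of_disjoint hp hα hβ hφd hψd hφ0 hψ0 hdisj hNα) hneg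
  refine hle.trans ?_
  have hd : ∀ r, (deriv (fun r => α * φ r - β * ψ r) r) ^ 2 * r
      = α ^ 2 * ((deriv φ r) ^ 2 * r) + β ^ 2 * ((deriv ψ r) ^ 2 * r) := fun r => by
    rw [deriv_const_mul_sub_const_mul α β hφd hψd]
    rcases hdisj r with h | h
    · rw [deriv_eq_zero_of_nonneg_of_eq_zero hφ0 h]; ring
    · rw [deriv_eq_zero_of_nonneg_of_eq_zero hψ0 h]; ring
  have hiφ : IntervalIntegrable (fun r => α ^ 2 * ((deriv φ r) ^ 2 * r)) volume 0 1 :=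
    (continuous_const.mul (((hφ.continuous_deriv le_rfl).pow 2).mul
      continuous_id)).intervalIntegrable _ _
  have hiψ : IntervalIntegrable (fun r => β ^ 2 * ((deriv ψ r) ^ 2 * r)) volume 0 1 :=
    (continuous_const.mul (((hψ.continuous_deriv le_rfl).pow 2).mul
      continuous_id)).intervalIntegrable _ _
  unfold radialEnergy
  simp only [hd]
  rw [intervalIntegral.integral_add hiφ hiψ, intervalIntegral.integral_const_mul,
    intervalIntegral.integral_const_mul]
  have hnn : 0 ≤ ∫ r in (0:ℝ)..1, |α * φ r - β * ψ r| ^ (p + 1) * r :=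
    intervalIntegral.integral_nonneg zero_le_one fun r hr =>
      mul_nonneg (Real.rpow_nonneg (abs_nonneg _) _) hr.1
  have : 0 ≤ 1 / (p + 1) * ∫ r in (0:ℝ)..1, |α * φ r - β * ψ r| ^ (p + 1) * r :=
    mul_nonneg (by positivity) hnn
  linarith

/-- A smooth bump which is positive exactly on `(0, 1)`. -/
def unitBump (t : ℝ) : ℝ := expNegInvGlue t * expNegInvGlue (1 - t)

lemma unitBump_contDiff : ContDiff ℝ 1 unitBump :=
  expNegInvGlue.contDiff.mul (expNegInvGlue.contDiff.comp (contDiff_const.sub contDiff_id))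

lemma unitBump_nonneg (t : ℝ) : 0 ≤ unitBump t :=
  mul_nonneg (expNegInvGlue.nonneg _) (expNegInvGlue.nonneg _)

lemma unitBump_eq_zero_of_nonpos {t : ℝ} (ht : t ≤ 0) : unitBump t = 0 := by
  rw [unitBump, expNegInvGlue.zero_of_nonpos ht, zero_mul]

lemma unitBump_eq_zero_of_one_le {t : ℝ} (ht : 1 ≤ t) : unitBump t = 0 := by
  rw [unitBump, expNegInvGlue.zero_of_nonpos (sub_nonpos.2 ht), mul_zero]

lemma unitBump_pos {t : ℝ} (h0 : 0 < t) (h1 : t < 1) : 0 < unitBump t :=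
  mul_pos (expNegInvGlue.pos_of_pos h0) (expNegInvGlue.pos_of_pos (sub_pos.2 h1))

/-- The bump in the logarithmic variable, supported in `exp (-(k+1) p) ≤ |r| ≤ exp (-k p)`. -/
def logBump (p k r : ℝ) : ℝ := unitBump (-log r / p - k)

lemma logBump_nonneg (p k r : ℝ) : 0 ≤ logBump p k r := unitBump_nonneg _

lemma logBump_eq_zero_of_lt {p k r : ℝ} (hp : 0 < p) (h0 : 0 < r)
    (hr : r < exp (-((k + 1) * p))) : logBump p k r = 0 := by
  refine unitBump_eq_zero_of_one_le ?_
  have hl : log r < -((k + 1) * p) := (Real.log_lt_iff_lt_exp h0).2 hr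
  have : k + 1 ≤ -log r / p := by rw [le_div_iff₀ hp]; linarith
  linarith

lemma logBump_contDiff {p k : ℝ} (hp : 0 < p) (hk : 0 ≤ k) : ContDiff ℝ 1 (logBump p k) := by
  rw [contDiff_iff_contDiffAt]
  intro r
  rcases eq_or_ne r 0 with rfl | hr
  · have hev : logBump p k =ᶠ[nhds 0] fun _ => (0:ℝ) := by
      filter_upwards [Metric.ball_mem_nhds (0:ℝ) (exp_pos (-((k + 1) * p)))] with x hx
      rw [Metric.mem_ball, dist_zero_right, Real.norm_eq_abs] at hx
      rcases eq_or_ne x 0 with rfl | hx0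
      · exact unitBump_eq_zero_of_nonpos (by simpa using hk)
      · rw [← logBump_eq_zero_of_lt hp (abs_pos.2 hx0) hx, logBump, logBump, Real.log_abs]
    exact contDiffAt_const.congr_of_eventuallyEq hev
  · exact unitBump_contDiff.contDiffAt.comp r
      (((Real.contDiffAt_log.2 hr).neg.div_const p).sub contDiffAt_const)

lemma logBump_one {p k : ℝ} (hk : 0 ≤ k) : logBump p k 1 = 0 :=
  unitBump_eq_zero_of_nonpos (by simpa using hk)

lemma logBump_disjoint (p r : ℝ) : logBump p 0 r = 0 ∨ logBump p 1 r = 0 := by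
  rcases le_total (-log r / p) 1 with h | h
  · exact Or.inr (unitBump_eq_zero_of_nonpos (by linarith))
  · exact Or.inl (unitBump_eq_zero_of_one_le (by linarith))

lemma logBump_exp {p k t : ℝ} (hp : 0 < p) : logBump p k (exp (-((k + t) * p))) = unitBump t := by
  rw [logBump, Real.log_exp, neg_neg, mul_div_cancel_right₀ _ hp.ne', add_sub_cancel_left]

lemma exists_logBump_pos {p k : ℝ} (hp : 0 < p) (hk : 0 ≤ k) :
    ∃ r ∈ Ioo (0:ℝ) 1, 0 < logBump p k r := by
  refine ⟨exp (-((k + 1 / 2) * p)), ⟨exp_pos _, ?_⟩, ?_⟩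
  · rw [Real.exp_lt_one_iff]
    have : 0 < (k + 1 / 2) * p := by positivity
    linarith
  · rw [logBump_exp hp]
    exact unitBump_pos (by norm_num) (by norm_num)

lemma integral_deriv_sq_pos {φ : ℝ → ℝ} (hφ : ContDiff ℝ 1 φ) (h1 : φ 1 = 0)
    (hpos : ∃ r ∈ Ioo (0:ℝ) 1, 0 < φ r) : 0 < ∫ r in (0:ℝ)..1, (deriv φ r) ^ 2 * r := by
  obtain ⟨r, hr, hφr⟩ := hpos
  obtain ⟨c, hc, hcd⟩ := exists_deriv_eq_slope φ hr.2 hφ.continuous.continuousOn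
    (hφ.differentiable one_ne_zero).differentiableOn
  have hne : deriv φ c ≠ 0 := by
    rw [hcd, h1, zero_sub]
    exact div_ne_zero (neg_ne_zero.2 hφr.ne') (sub_pos.2 hr.2).ne'
  have hc0 : 0 < c := hr.1.trans hc.1
  refine intervalIntegral.integral_pos zero_lt_one
    (((hφ.continuous_deriv le_rfl).pow 2).mul continuous_id).continuousOn
    (fun x hx => mul_nonneg (sq_nonneg _) hx.1.le) ⟨c, ⟨hc0.le, hc.2.le⟩, by positivity⟩

lemma exists_integral_deriv_logBump_le :
    ∃ M > (0:ℝ), ∀ p > (0:ℝ), ∀ k ∈ Icc (0:ℝ) 1,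
      ∫ r in (0:ℝ)..1, (deriv (logBump p k) r) ^ 2 * r ≤ M / p := by
  obtain ⟨M, hM⟩ := (isCompact_Icc (a := (-1:ℝ)) (b := 2)).exists_bound_of_continuousOn
    (unitBump_contDiff.continuous_deriv le_rfl).continuousOn
  refine ⟨2 * M ^ 2 + 1, by positivity, fun p hp k hk => ?_⟩
  have hcont : Continuous fun r => (deriv (logBump p k) r) ^ 2 * r :=
    (((logBump_contDiff hp hk.1).continuous_deriv le_rfl).pow 2).mul continuous_id
  set a := exp (-(2 * p)) with ha
  have ha0 : 0 < a := exp_pos _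
  have ha1 : a ≤ 1 := Real.exp_le_one_iff.2 (by linarith)
  rw [← intervalIntegral.integral_add_adjacent_intervals
    (hcont.intervalIntegrable 0 a) (hcont.intervalIntegrable a 1)]
  have hzero : ∫ r in (0:ℝ)..a, (deriv (logBump p k) r) ^ 2 * r = 0 := by
    refine intervalIntegral.integral_zero_ae ?_
    have h1 : ∀ᵐ r : ℝ, r ≠ a := by simp [ae_iff]
    filter_upwards [h1] with r hra hr
    rw [uIoc_of_le ha0.le] at hr
    have hlt : r < exp (-((k + 1) * p)) := by
      refine (lt_of_le_of_ne hr.2 hra).trans_le (Real.exp_le_exp.2 ?_)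
      nlinarith [hk.2]
    rw [deriv_eq_zero_of_nonneg_of_eq_zero (logBump_nonneg p k)
      (logBump_eq_zero_of_lt hp hr.1 hlt)]
    ring
  have hle : ∫ r in a..1, (deriv (logBump p k) r) ^ 2 * r ≤ ∫ r in a..1, M ^ 2 / p ^ 2 * r⁻¹ := by
    refine intervalIntegral.integral_mono_on ha1 (hcont.intervalIntegrable _ _) ?_ ?_
    · refine ContinuousOn.intervalIntegrable_of_Icc ha1 ?_
      exact continuousOn_const.mul
        (continuousOn_id.inv₀ fun x hx => (ha0.trans_le hx.1).ne')
    · intro r hr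
      have hr0 : 0 < r := ha0.trans_le hr.1
      have hd : HasDerivAt (logBump p k)
          (deriv unitBump (-log r / p - k) * (-r⁻¹ / p)) r := by
        have h1 : HasDerivAt (fun r => -log r / p - k) (-r⁻¹ / p) r :=
          ((Real.hasDerivAt_log hr0.ne').neg.div_const p).sub_const k
        exact ((unitBump_contDiff.differentiable one_ne_zero _).hasDerivAt).comp r h1
      have hl1 : log r ≤ 0 := Real.log_nonpos hr0.le hr.2
      have hl2 : -(2 * p) ≤ log r := (Real.le_log_iff_exp_le hr0).2 hr.1
      have ht : -log r / p - k ∈ Icc (-1:ℝ) 2 := by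
        have h1 : 0 ≤ -log r / p := div_nonneg (by linarith) hp.le
        have h2 : -log r / p ≤ 2 := by rw [div_le_iff₀ hp]; linarith
        constructor <;> linarith [hk.1, hk.2]
      have hb := hM _ ht
      have hb2 : (deriv unitBump (-log r / p - k)) ^ 2 ≤ M ^ 2 := by
        rw [Real.norm_eq_abs] at hb
        exact sq_le_sq' (abs_le.1 hb).1 (abs_le.1 hb).2
      rw [hd.deriv]
      calc (deriv unitBump (-log r / p - k) * (-r⁻¹ / p)) ^ 2 * r
          = (deriv unitBump (-log r / p - k)) ^ 2 * (1 / p ^ 2 * r⁻¹) := by field_simp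
        _ ≤ M ^ 2 * (1 / p ^ 2 * r⁻¹) := by gcongr
        _ = M ^ 2 / p ^ 2 * r⁻¹ := by ring
  have hval : ∫ r in a..1, M ^ 2 / p ^ 2 * r⁻¹ = 2 * M ^ 2 / p := by
    rw [intervalIntegral.integral_const_mul, integral_inv_of_pos ha0 one_pos, one_div,
      Real.log_inv, ha, Real.log_exp]
    field_simp
  rw [hzero, zero_add]
  refine hle.trans (hval.le.trans ?_)
  gcongr
  linarith

lemma exists_le_integral_logBump_rpow :
    ∃ b ∈ Ioc (0:ℝ) 1, ∀ p ≥ (3:ℝ), ∀ k ∈ Icc (0:ℝ) 1,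
      b ^ p ≤ ∫ r in (0:ℝ)..1, (logBump p k r) ^ (p + 1) * r := by
  obtain ⟨t₀, ht₀, hmin⟩ := (isCompact_Icc (a := (1 / 3 : ℝ)) (b := 2 / 3)).exists_isMinOn
    ⟨1 / 2, by norm_num⟩ unitBump_contDiff.continuous.continuousOn
  set m := min (unitBump t₀) 1 with hm
  have hm0 : 0 < m := lt_min (unitBump_pos (by linarith [ht₀.1]) (by linarith [ht₀.2])) one_pos
  have hm1 : m ≤ 1 := min_le_right _ _
  have he1 : exp (-4) ≤ 1 := Real.exp_le_one_iff.2 (by norm_num)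
  refine ⟨m ^ 2 * exp (-4) / 4, ⟨by positivity, ?_⟩, fun p hp k hk => ?_⟩
  · have h1 : m ^ 2 ≤ 1 := pow_le_one₀ hm0.le hm1
    have h2 : m ^ 2 * exp (-4) ≤ 1 := mul_le_one₀ h1 (exp_pos _).le he1
    linarith
  have hp0 : 0 < p := by linarith
  set c := exp (-((k + 2 / 3) * p)) with hc
  set d := exp (-((k + 1 / 3) * p)) with hd
  have hc0 : 0 < c := exp_pos _
  have hcd : c ≤ d := Real.exp_le_exp.2 (by nlinarith)
  have hd1 : d ≤ 1 := Real.exp_le_one_iff.2 (by nlinarith [mul_nonneg hk.1 hp0.le])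
  have hcont : Continuous fun r => (logBump p k r) ^ (p + 1) * r :=
    ((logBump_contDiff hp0 hk.1).continuous.rpow_const fun _ => Or.inr (by linarith)).mul
      continuous_id
  have hsub : ∫ r in c..d, (logBump p k r) ^ (p + 1) * r
      ≤ ∫ r in (0:ℝ)..1, (logBump p k r) ^ (p + 1) * r := by
    refine intervalIntegral.integral_mono_interval hc0.le hcd hd1 ?_ (hcont.intervalIntegrable _ _)
    refine (ae_restrict_iff' measurableSet_Ioc).2 (Eventually.of_forall fun r hr => ?_)
    exact mul_nonneg (Real.rpow_nonneg (logBump_nonneg _ _ _) _) hr.1.le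
  have hmono : ∫ r in c..d, m ^ (p + 1) * r ≤ ∫ r in c..d, (logBump p k r) ^ (p + 1) * r := by
    refine intervalIntegral.integral_mono_on hcd
      ((continuous_const.mul continuous_id).intervalIntegrable _ _)
      (hcont.intervalIntegrable _ _) fun r hr => ?_
    have hr0 : 0 < r := hc0.trans_le hr.1
    have hl1 : log r ≤ -((k + 1 / 3) * p) := (Real.log_le_iff_le_exp hr0).2 hr.2
    have hl2 : -((k + 2 / 3) * p) ≤ log r := (Real.le_log_iff_exp_le hr0).2 hr.1
    have ht : -log r / p - k ∈ Icc (1 / 3 : ℝ) (2 / 3) := by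
      have h1 : k + 1 / 3 ≤ -log r / p := by rw [le_div_iff₀ hp0]; linarith
      have h2 : -log r / p ≤ k + 2 / 3 := by rw [div_le_iff₀ hp0]; linarith
      constructor <;> linarith
    have : m ≤ logBump p k r := (min_le_left _ _).trans (hmin ht)
    gcongr
  refine le_trans ?_ (hmono.trans hsub)
  rw [intervalIntegral.integral_const_mul, integral_id]
  have hc2 : c ^ 2 ≤ d ^ 2 / 2 := by
    have hcd' : c ^ 2 = d ^ 2 * exp (-(2 / 3 * p)) := by
      rw [hc, hd, ← Real.exp_nat_mul, ← Real.exp_nat_mul, ← Real.exp_add]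
      congr 1
      push_cast
      ring
    have hhalf : exp (-(2 / 3 * p)) ≤ 1 / 2 := by
      rw [Real.exp_neg, inv_le_comm₀ (exp_pos _) (by norm_num)]
      have := Real.add_one_le_exp (2 / 3 * p)
      norm_num
      linarith
    rw [hcd']
    nlinarith [sq_nonneg d]
  have hd2 : exp (-4) ^ p ≤ d ^ 2 := by
    rw [hd, ← Real.exp_mul, ← Real.exp_nat_mul]
    refine Real.exp_le_exp.2 ?_
    push_cast
    nlinarith [hk.2]
  have hmp : (m ^ 2) ^ p ≤ m ^ (p + 1) := by
    rw [← Real.rpow_two, ← Real.rpow_mul hm0.le]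
    exact Real.rpow_le_rpow_of_exponent_ge hm0 hm1 (by linarith)
  have h4 : (1 / 4 : ℝ) ^ p ≤ 1 / 4 := by
    simpa using Real.rpow_le_rpow_of_exponent_ge (x := (1 / 4 : ℝ)) (by norm_num) (by norm_num)
      (show (1:ℝ) ≤ p by linarith)
  calc (m ^ 2 * exp (-4) / 4) ^ p = (m ^ 2) ^ p * (exp (-4) ^ p * (1 / 4) ^ p) := by
        rw [div_eq_mul_one_div, mul_assoc, Real.mul_rpow (by positivity) (by positivity),
          Real.mul_rpow (by positivity) (by positivity)]
    _ ≤ m ^ (p + 1) * (d ^ 2 * (1 / 4)) := by gcongr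
    _ ≤ m ^ (p + 1) * ((d ^ 2 - c ^ 2) / 2) := by gcongr; linarith

lemma nehariScale_sq_le {p M b : ℝ} (hp : 3 ≤ p) (hM : 0 < M) (hb : b ∈ Ioc (0:ℝ) 1) {φ : ℝ → ℝ}
    (hA0 : 0 < ∫ r in (0:ℝ)..1, (deriv φ r) ^ 2 * r)
    (hA : ∫ r in (0:ℝ)..1, (deriv φ r) ^ 2 * r ≤ M / p)
    (hB : b ^ p ≤ ∫ r in (0:ℝ)..1, (φ r) ^ (p + 1) * r) :
    nehariScale p φ ^ 2 ≤ (max M 1 / b) ^ 3 := by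
  have hb0 := hb.1
  have hbp : 0 < b ^ p := Real.rpow_pos_of_pos hb0 _
  have hK1 : 1 ≤ max M 1 := le_max_right _ _
  have hK : 1 ≤ max M 1 / b := by rw [one_le_div hb0]; exact hb.2.trans hK1
  have hAK : ∫ r in (0:ℝ)..1, (deriv φ r) ^ 2 * r ≤ max M 1 ^ p := by
    refine hA.trans (le_trans ?_ (Real.self_le_rpow_of_one_le hK1 (by linarith)))
    exact (div_le_self hM.le (by linarith)).trans (le_max_left _ _)
  have hquot : (∫ r in (0:ℝ)..1, (deriv φ r) ^ 2 * r) / ∫ r in (0:ℝ)..1, (φ r) ^ (p + 1) * r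
      ≤ (max M 1 / b) ^ p := by
    rw [Real.div_rpow (by positivity) hb0.le]
    exact div_le_div₀ (by positivity) hAK hbp hB
  have hq0 : 0 ≤ (∫ r in (0:ℝ)..1, (deriv φ r) ^ 2 * r) /
      ∫ r in (0:ℝ)..1, (φ r) ^ (p + 1) * r := div_nonneg hA0.le (hbp.le.trans hB)
  rw [nehariScale, ← Real.rpow_natCast, ← Real.rpow_mul hq0]
  have hp1 : 0 < p - 1 := by linarith
  refine (Real.rpow_le_rpow hq0 hquot (by positivity)).trans ?_
  rw [← Real.rpow_mul (by positivity), ← Real.rpow_natCast]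
  refine Real.rpow_le_rpow_of_exponent_le hK ?_
  push_cast
  rw [show p * (1 / (p - 1) * 2) = 2 * p / (p - 1) by ring, div_le_iff₀ hp1]
  linarith

/-- There is a constant `C > 0`, independent of `p`, such that for all
sufficiently large `p > 1` one has `p·∫_B |∇u_p|² ≤ C` (equivalently,
`p·∫_B |u_p|^{p+1} ≤ C`); the integrals over `B` are written in polar coordinates. -/
theorem energy_bound (F : LaneEmdenFamily) :
    ∃ C > (0:ℝ), ∃ p₀ > (1:ℝ), ∀ p ≥ p₀,
      p * (2 * π * ∫ r in (0:ℝ)..1, (deriv (F.u p) r) ^ 2 * r) ≤ C ∧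
      p * (2 * π * ∫ r in (0:ℝ)..1, |F.u p r| ^ (p + 1) * r) ≤ C := by
  obtain ⟨M, hM, hA⟩ := exists_integral_deriv_logBump_le
  obtain ⟨b, hb, hB⟩ := exists_le_integral_logBump_rpow
  set K := (max M 1 / b) ^ 3 with hKdef
  have hK : 0 < K := by
    have := hb.1
    positivity
  refine ⟨8 * π * (K * M), by positivity, 3, by norm_num, fun p hp => ?_⟩
  have hp3 : 3 ≤ p := hp
  have hp1 : 1 < p := by linarith
  have hp0 : 0 < p := by linarith
  have hbump : ∀ k ∈ Icc (0:ℝ) 1,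
      0 < ∫ r in (0:ℝ)..1, (deriv (logBump p k) r) ^ 2 * r ∧
      0 < ∫ r in (0:ℝ)..1, (logBump p k r) ^ (p + 1) * r ∧
      nehariScale p (logBump p k) ^ 2 * (∫ r in (0:ℝ)..1, (deriv (logBump p k) r) ^ 2 * r)
        ≤ K * (M / p) := by
    intro k hk
    have hApos := integral_deriv_sq_pos (logBump_contDiff hp0 hk.1) (logBump_one hk.1)
      (exists_logBump_pos hp0 hk.1)
    exact ⟨hApos, (Real.rpow_pos_of_pos hb.1 p).trans_le (hB p hp k hk),
      mul_le_mul (nehariScale_sq_le hp3 hM hb hApos (hA p hp0 k hk) (hB p hp k hk))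
        (hA p hp0 k hk) hApos.le hK.le⟩
  obtain ⟨hA₀, hB₀, hle₀⟩ := hbump 0 (by simp)
  obtain ⟨hA₁, hB₁, hle₁⟩ := hbump 1 (by simp)
  have henergy := F.radialEnergy_le hp1 (logBump_contDiff hp0 le_rfl)
    (logBump_contDiff hp0 zero_le_one) (logBump_nonneg p 0) (logBump_nonneg p 1)
    (logBump_disjoint p) (logBump_one le_rfl) (logBump_one zero_le_one)
    (exists_logBump_pos hp0 le_rfl) (exists_logBump_pos hp0 zero_le_one) hA₀ hB₀ hA₁ hB₁
  have hnehari := integral_deriv_sq_eq_of_ode hp1 (F.smooth p hp1) (F.ode p hp1) (F.boundary p hp1)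
  have hI : 0 ≤ ∫ r in (0:ℝ)..1, (deriv (F.u p) r) ^ 2 * r :=
    intervalIntegral.integral_nonneg zero_le_one fun r hr => mul_nonneg (sq_nonneg _) hr.1
  have hbound : p * (2 * π * ∫ r in (0:ℝ)..1, (deriv (F.u p) r) ^ 2 * r) ≤ 8 * π * (K * M) := by
    rw [radialEnergy, ← hnehari] at henergy
    set I := ∫ r in (0:ℝ)..1, (deriv (F.u p) r) ^ 2 * r
    have hquarter : 1 / (p + 1) ≤ 1 / 4 := one_div_le_one_div_of_le (by norm_num) (by linarith)
    have hI4 : I ≤ 4 * (K * (M / p)) := by nlinarith [mul_le_mul_of_nonneg_right hquarter hI]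
    calc p * (2 * π * I) ≤ p * (2 * π * (4 * (K * (M / p)))) := by gcongr
      _ = 8 * π * (K * M) := by field_simp; ring
  exact ⟨hbound, hnehari ▸ hbound⟩
end
end

section
/- The radius r_p of the nodal circle of u_p tends to 0 as p → +∞. -/
open Real MeasureTheory Set Filter

noncomputable section

/-- A function with nonnegative derivative on an open interval does not decrease between the
endpoints. -/
theorem le_of_hasDerivAt_nonneg {f f' : ℝ → ℝ} {a b : ℝ} (hab : a ≤ b)
    (hc : ContinuousOn f (Icc a b)) (hd : ∀ x ∈ Ioo a b, HasDerivAt f (f' x) x)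
    (hn : ∀ x ∈ Ioo a b, 0 ≤ f' x) : f a ≤ f b := by
  rcases hab.eq_or_lt with rfl | hlt
  · exact le_rfl
  obtain ⟨c, hcm, hce⟩ := exists_hasDerivAt_eq_slope f f' hlt hc hd
  have h := hn c hcm
  rw [hce, le_div_iff₀ (sub_pos.2 hlt)] at h
  linarith

/-- A function with nonpositive derivative on an open interval does not increase between the
endpoints. -/
theorem le_of_hasDerivAt_nonpos {f f' : ℝ → ℝ} {a b : ℝ} (hab : a ≤ b)
    (hc : ContinuousOn f (Icc a b)) (hd : ∀ x ∈ Ioo a b, HasDerivAt f (f' x) x)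
    (hn : ∀ x ∈ Ioo a b, f' x ≤ 0) : f b ≤ f a := by
  have h := le_of_hasDerivAt_nonneg (f := fun x => -f x) hab hc.neg
    (fun x hx => (hd x hx).neg) (fun x hx => neg_nonneg.2 (hn x hx))
  linarith

/-- A positive radial profile `w` of the Lane–Emden equation on the disc of radius `R`, vanishing
on its boundary; `h r` stands for `r * w' r`. -/
structure PositiveDiscProfile (p R : ℝ) (w h : ℝ → ℝ) : Prop where
  one_lt : 1 < p
  radius_pos : 0 < R
  continuousOn : ContinuousOn w (Icc 0 R)
  continuousOn_flux : ContinuousOn h (Icc 0 R)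
  hasDerivAt : ∀ r ∈ Ioo 0 R, HasDerivAt w (h r / r) r
  hasDerivAt_flux : ∀ r ∈ Ioo 0 R, HasDerivAt h (-(r * w r ^ p)) r
  flux_zero : h 0 = 0
  pos : ∀ r ∈ Ico 0 R, 0 < w r
  boundary : w R = 0
  le_center : ∀ r ∈ Icc 0 R, w r ≤ w 0

namespace PositiveDiscProfile

variable {p R : ℝ} {w h : ℝ → ℝ}

theorem center_pos (H : PositiveDiscProfile p R w h) : 0 < w 0 :=
  H.pos 0 ⟨le_rfl, H.radius_pos⟩

theorem flux_antitone (H : PositiveDiscProfile p R w h) {a b : ℝ} (ha : 0 ≤ a) (hab : a ≤ b)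
    (hb : b ≤ R) : h b ≤ h a := by
  refine le_of_hasDerivAt_nonpos hab (H.continuousOn_flux.mono (Icc_subset_Icc ha hb))
    (fun x hx => H.hasDerivAt_flux x ⟨ha.trans_lt hx.1, hx.2.trans_le hb⟩) fun x hx => ?_
  have hx0 : 0 < x := ha.trans_lt hx.1
  have := H.pos x ⟨hx0.le, hx.2.trans_le hb⟩
  have : 0 ≤ x * w x ^ p := by positivity
  linarith

theorem flux_lower (H : PositiveDiscProfile p R w h) {r : ℝ} (hr : r ∈ Icc 0 R) :
    -(w 0 ^ p * r ^ 2 / 2) ≤ h r := by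
  have key := le_of_hasDerivAt_nonneg (f := fun x => h x + w 0 ^ p / 2 * x ^ 2)
    (f' := fun x => -(x * w x ^ p) + w 0 ^ p / 2 * (2 * x)) hr.1
    ((H.continuousOn_flux.mono (Icc_subset_Icc le_rfl hr.2)).add (by fun_prop))
    (fun x hx => ((H.hasDerivAt_flux x ⟨hx.1, hx.2.trans_le hr.2⟩).add
        ((hasDerivAt_pow 2 x).const_mul (w 0 ^ p / 2))).congr_deriv (by simp))
    (fun x hx => by
      have hxR : x < R := hx.2.trans_le hr.2
      have hp : w x ^ p ≤ w 0 ^ p := rpow_le_rpow (H.pos x ⟨hx.1.le, hxR⟩).le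
        (H.le_center x ⟨hx.1.le, hxR.le⟩) (by linarith [H.one_lt])
      have := mul_le_mul_of_nonneg_left hp hx.1.le
      linarith)
  simp only [H.flux_zero] at key
  linarith

theorem profile_lower (H : PositiveDiscProfile p R w h) {r : ℝ} (hr : r ∈ Icc 0 R) :
    w 0 - w 0 ^ p * r ^ 2 / 4 ≤ w r := by
  have key := le_of_hasDerivAt_nonneg (f := fun x => w x + w 0 ^ p / 4 * x ^ 2)
    (f' := fun x => h x / x + w 0 ^ p / 4 * (2 * x)) hr.1
    ((H.continuousOn.mono (Icc_subset_Icc le_rfl hr.2)).add (by fun_prop))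
    (fun x hx => ((H.hasDerivAt x ⟨hx.1, hx.2.trans_le hr.2⟩).add
        ((hasDerivAt_pow 2 x).const_mul (w 0 ^ p / 4))).congr_deriv (by simp))
    (fun x hx => by
      have hf := H.flux_lower (r := x) ⟨hx.1.le, hx.2.le.trans hr.2⟩
      have h1 : h x / x + w 0 ^ p / 4 * (2 * x) = (h x + w 0 ^ p * x ^ 2 / 2) / x := by
        have := hx.1.ne'
        field_simp
        ring
      rw [h1]
      exact div_nonneg (by linarith) hx.1.le)
  linarith

/-- The height of a positive profile on a disc is controlled by the radius. -/
theorem height_bound (H : PositiveDiscProfile p R w h) :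
    p * R ^ 2 * w 0 ^ (p - 1) ≤ 2 * exp (4 * p) := by
  have hp := H.one_lt
  have hM := H.center_pos
  have hMp : 0 < w 0 ^ (p - 1) := rpow_pos_of_pos hM _
  have hMs : w 0 ^ p = w 0 ^ (p - 1) * w 0 := by
    rw [← rpow_add_one hM.ne']; ring_nf
  obtain ⟨ε, hε, hε2⟩ : ∃ ε : ℝ, 0 < ε ∧ p * w 0 ^ (p - 1) * ε ^ 2 = 2 := by
    refine ⟨√(2 / (p * w 0 ^ (p - 1))), by positivity, ?_⟩
    rw [sq_sqrt (by positivity)]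
    field_simp
  have hlow : ∀ r ∈ Icc 0 R, r ≤ ε → w 0 * (1 + -(1 / (2 * p))) ≤ w r := by
    intro r hr hrε
    refine le_trans ?_ (H.profile_lower hr)
    have h1 : w 0 ^ p * r ^ 2 ≤ w 0 ^ p * ε ^ 2 := by
      have := hr.1
      gcongr
    have h2 : w 0 ^ p * ε ^ 2 = 2 * w 0 / p := by
      rw [hMs]
      field_simp
      linear_combination hε2
    have h3 : w 0 * (1 + -(1 / (2 * p))) = w 0 - 2 * w 0 / p / 4 := by
      field_simp
      ring
    linarith
  have hsmall : 1 / (2 * p) ≤ 1 / 2 := by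
    rw [div_le_div_iff₀ (by positivity) (by positivity)]
    linarith
  have hεR : ε < R := by
    by_contra! hle
    have h1 := hlow R ⟨H.radius_pos.le, le_rfl⟩ hle
    rw [H.boundary] at h1
    have : 0 < w 0 * (1 + -(1 / (2 * p))) := mul_pos hM (by linarith)
    linarith
  have hpow : ∀ r ∈ Ioo 0 ε, w 0 ^ p / 2 ≤ w r ^ p := by
    intro r hr
    have h1 := hlow r ⟨hr.1.le, hr.2.le.trans hεR.le⟩ hr.2.le
    have h2 : 1 + p * (-(1 / (2 * p))) ≤ (1 + -(1 / (2 * p))) ^ p :=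
      one_add_mul_self_le_rpow_one_add (by linarith) hp.le
    have h3 : 1 + p * (-(1 / (2 * p))) = 1 / 2 := by
      field_simp
      norm_num
    calc w 0 ^ p / 2 = w 0 ^ p * (1 / 2) := by ring
      _ ≤ w 0 ^ p * (1 + -(1 / (2 * p))) ^ p := by
        rw [← h3]; gcongr
      _ = (w 0 * (1 + -(1 / (2 * p)))) ^ p :=
        (mul_rpow hM.le (by linarith)).symm
      _ ≤ w r ^ p := rpow_le_rpow (mul_nonneg hM.le (by linarith)) h1 (by linarith)
  have hflux : h ε ≤ -(w 0 / (2 * p)) := by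
    have key := le_of_hasDerivAt_nonpos (f := fun x => h x + w 0 ^ p / 4 * x ^ 2)
      (f' := fun x => -(x * w x ^ p) + w 0 ^ p / 4 * (2 * x)) hε.le
      ((H.continuousOn_flux.mono (Icc_subset_Icc le_rfl hεR.le)).add (by fun_prop))
      (fun x hx => ((H.hasDerivAt_flux x ⟨hx.1, hx.2.trans hεR⟩).add
          ((hasDerivAt_pow 2 x).const_mul (w 0 ^ p / 4))).congr_deriv (by simp))
      (fun x hx => by
        have := mul_le_mul_of_nonneg_left (hpow x hx) hx.1.le
        linarith)
    have h2 : w 0 ^ p / 4 * ε ^ 2 = w 0 / (2 * p) := by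
      rw [hMs]
      field_simp
      linear_combination 2 * hε2
    simp only [H.flux_zero, h2] at key
    linarith
  have hlog : log (R / ε) ≤ 2 * p := by
    have key := le_of_hasDerivAt_nonpos (f := fun x => w x + w 0 / (2 * p) * log x)
      (f' := fun x => h x / x + w 0 / (2 * p) * x⁻¹) hεR.le
      ((H.continuousOn.mono (Icc_subset_Icc hε.le le_rfl)).add
        (continuousOn_const.mul (continuousOn_log.mono fun x hx => (hε.trans_le hx.1).ne')))
      (fun x hx => (H.hasDerivAt x ⟨hε.trans hx.1, hx.2⟩).add
        ((hasDerivAt_log (hε.trans hx.1).ne').const_mul (w 0 / (2 * p))))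
      (fun x hx => by
        have h1 := H.flux_antitone hε.le hx.1.le hx.2.le
        rw [← div_eq_mul_inv, ← add_div]
        exact div_nonpos_of_nonpos_of_nonneg (by linarith) (hε.trans hx.1).le)
    have h1 := H.le_center ε ⟨hε.le, hεR.le⟩
    simp only [H.boundary] at key
    rw [log_div H.radius_pos.ne' hε.ne']
    have h2 : w 0 / (2 * p) * (log R - log ε) ≤ w 0 / (2 * p) * (2 * p) := by
      have : w 0 / (2 * p) * (2 * p) = w 0 := by field_simp
      linarith
    exact le_of_mul_le_mul_left h2 (by positivity)
  have hRε : R ≤ ε * exp (2 * p) := by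
    have h1 := (log_le_iff_le_exp (div_pos H.radius_pos hε)).1 hlog
    rwa [div_le_iff₀' hε] at h1
  have hR2 : R ^ 2 ≤ ε ^ 2 * exp (4 * p) := by
    have h1 : exp (4 * p) = exp (2 * p) ^ 2 := by
      rw [← exp_nat_mul]; congr 1; push_cast; ring
    rw [h1, ← mul_pow]
    exact pow_le_pow_left₀ H.radius_pos.le hRε 2
  calc p * R ^ 2 * w 0 ^ (p - 1) = p * w 0 ^ (p - 1) * R ^ 2 := by ring
    _ ≤ p * w 0 ^ (p - 1) * (ε ^ 2 * exp (4 * p)) := by gcongr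
    _ = 2 * exp (4 * p) := by rw [← mul_assoc, hε2]

/-- A Pohozaev-type bound: the boundary flux is controlled by the height divided by `p + 1`. -/
theorem flux_bound (H : PositiveDiscProfile p R w h) : -h R ≤ 4 * w 0 / (p + 1) := by
  have hp := H.one_lt
  have hM := H.center_pos
  have key := le_of_hasDerivAt_nonpos
    (f := fun x => h x ^ 2 / 2 + x ^ 2 * w x ^ (p + 1) / (p + 1) + 2 * w 0 / (p + 1) * h x)
    (f' := fun x => 2 * x / (p + 1) * w x ^ p * (w x - w 0)) H.radius_pos.le
    (by
      have h1 := H.continuousOn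
      have h2 := H.continuousOn_flux
      have h3 : ContinuousOn (fun x => w x ^ (p + 1)) (Icc 0 R) :=
        h1.rpow_const fun x _ => Or.inr (by linarith)
      fun_prop)
    (fun x hx => by
      have hw := H.pos x ⟨hx.1.le, hx.2⟩
      have d1 := H.hasDerivAt_flux x hx
      have d2 := (H.hasDerivAt x hx).rpow_const (p := p + 1) (Or.inl hw.ne')
      have d := (((d1.pow 2).div_const 2).add
        (((hasDerivAt_pow 2 x).mul d2).div_const (p + 1))).add
          (d1.const_mul (2 * w 0 / (p + 1)))
      refine d.congr_deriv ?_
      have h1 : w x ^ (p + 1) = w x ^ p * w x := rpow_add_one hw.ne' p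
      have h2 : p + 1 - 1 = p := by ring
      have hx0 := hx.1.ne'
      have hp1 : p + 1 ≠ 0 := by linarith
      simp only [h1, h2]
      field_simp
      push_cast
      ring)
    (fun x hx => by
      have hw := H.pos x ⟨hx.1.le, hx.2⟩
      have hle := H.le_center x ⟨hx.1.le, hx.2.le⟩
      have hx0 := hx.1
      exact mul_nonpos_of_nonneg_of_nonpos (by positivity) (by linarith))
  have hz : (0 : ℝ) ^ (p + 1) = 0 := zero_rpow (by linarith)
  simp only [H.flux_zero, H.boundary, hz] at key
  have hnn : h R ≤ 0 := H.flux_zero ▸ H.flux_antitone le_rfl H.radius_pos.le le_rfl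
  rcases hnn.eq_or_lt with h0 | h0
  · rw [h0]
    have : 0 ≤ 4 * w 0 / (p + 1) := by positivity
    linarith
  · have h3 : 4 * w 0 / (p + 1) = 2 * (2 * w 0 / (p + 1)) := by ring
    rw [h3]
    by_contra! hlt
    have hprod : h R * (h R + 2 * (2 * w 0 / (p + 1))) ≤ 0 := by
      ring_nf at key ⊢
      linarith
    exact hprod.not_gt (mul_pos_of_neg_of_neg h0 (by linarith))

end PositiveDiscProfile

/-- On an annulus `R < r < 1`, a positive radial profile vanishing on both boundary circles has an
inner flux `g R` that cannot be too small. -/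
theorem annulus_flux_bound {p R : ℝ} {u g : ℝ → ℝ} (hp : 1 < p) (hR0 : 0 < R) (hR1 : R < 1)
    (hu : ContinuousOn u (Icc R 1)) (hg : ContinuousOn g (Icc R 1))
    (hu' : ∀ r ∈ Ioo R 1, HasDerivAt u (g r / r) r)
    (hg' : ∀ r ∈ Ioo R 1, HasDerivAt g (-(r * u r ^ p)) r)
    (huR : u R = 0) (hu1 : u 1 = 0) (hpos : ∀ r ∈ Ioo R 1, 0 < u r) :
    0 < g R ∧ g R ≤ (g R * log (1 / R)) ^ p := by
  have hanti : ∀ r ∈ Ioo R 1, g r ≤ g R := fun r hr =>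
    le_of_hasDerivAt_nonpos hr.1.le (hg.mono (Icc_subset_Icc le_rfl hr.2.le))
      (fun x hx => hg' x ⟨hx.1, hx.2.trans hr.2⟩) (fun x hx => by
        have h1 := hpos x ⟨hx.1, hx.2.trans hr.2⟩
        have h2 : 0 < x := hR0.trans hx.1
        have : 0 ≤ x * u x ^ p := by positivity
        linarith)
  have hupper : ∀ r ∈ Ioo R 1, u r ≤ g R * log (r / R) := by
    intro r hr
    have key := le_of_hasDerivAt_nonpos (f := fun x => u x - g R * log x)
      (f' := fun x => g x / x - g R * x⁻¹) hr.1.le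
      ((hu.mono (Icc_subset_Icc le_rfl hr.2.le)).sub
        (continuousOn_const.mul (continuousOn_log.mono fun x hx => (hR0.trans_le hx.1).ne')))
      (fun x hx => (hu' x ⟨hx.1, hx.2.trans hr.2⟩).sub
        ((hasDerivAt_log (hR0.trans hx.1).ne').const_mul (g R)))
      (fun x hx => by
        have h1 := hanti x ⟨hx.1, hx.2.trans hr.2⟩
        rw [← div_eq_mul_inv, ← sub_div]
        exact div_nonpos_of_nonpos_of_nonneg (by linarith) (hR0.trans hx.1).le)
    simp only [huR] at key
    rw [log_div (hR0.trans hr.1).ne' hR0.ne']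
    linarith
  have hα : 0 < g R := by
    have hm : (R + 1) / 2 ∈ Ioo R 1 := ⟨by linarith, by linarith⟩
    have h1 := (hpos _ hm).trans_le (hupper _ hm)
    have h2 : 0 < log ((R + 1) / 2 / R) := log_pos (by rw [one_lt_div hR0]; exact hm.1)
    exact pos_of_mul_pos_left h1 h2.le
  refine ⟨hα, ?_⟩
  have hbound : ∀ r ∈ Ioo R 1, u r ≤ g R * log (1 / R) := fun r hr =>
    (hupper r hr).trans (by
      have := hR0.trans hr.1
      have := hr.2.le
      gcongr)
  obtain ⟨ξ, hξ, hξ0⟩ := exists_hasDerivAt_eq_zero hR1 hu (huR.trans hu1.symm) hu'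
  have hgξ : g ξ = 0 := by
    rcases div_eq_zero_iff.1 hξ0 with h | h
    · exact h
    · exact absurd h (hR0.trans hξ.1).ne'
  have key := le_of_hasDerivAt_nonneg
    (f := fun x => g x + (g R * log (1 / R)) ^ p * x)
    (f' := fun x => -(x * u x ^ p) + (g R * log (1 / R)) ^ p * 1) hξ.1.le
    ((hg.mono (Icc_subset_Icc le_rfl hξ.2.le)).add (by fun_prop))
    (fun x hx => (hg' x ⟨hx.1, hx.2.trans hξ.2⟩).add ((hasDerivAt_id x).const_mul _))
    (fun x hx => by
      have hx' : x ∈ Ioo R 1 := ⟨hx.1, hx.2.trans hξ.2⟩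
      have h1 : u x ^ p ≤ (g R * log (1 / R)) ^ p :=
        rpow_le_rpow (hpos x hx').le (hbound x hx') (by linarith)
      have h2 : 0 ≤ u x ^ p := rpow_nonneg (hpos x hx').le p
      nlinarith [hx'.2])
  simp only [hgξ] at key
  have hnn : 0 ≤ (g R * log (1 / R)) ^ p :=
    rpow_nonneg (mul_nonneg hα.le (log_nonneg (by rw [le_div_iff₀ hR0]; linarith))) p
  nlinarith [hξ.2]

namespace LaneEmdenFamily

/-- The flux `r * u' r`, with the one-sided derivative at the endpoints of `[0, 1]`. -/
def flux (F : LaneEmdenFamily) (p r : ℝ) : ℝ :=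
  r * derivWithin (F.u p) (Icc 0 1) r

variable (F : LaneEmdenFamily) {p : ℝ}

theorem continuousOn_u (hp : 1 < p) : ContinuousOn (F.u p) (Icc 0 1) :=
  (F.smooth p hp).continuousOn

theorem continuousOn_flux (hp : 1 < p) : ContinuousOn (F.flux p) (Icc 0 1) :=
  continuousOn_id.mul ((F.smooth p hp).continuousOn_derivWithin
    (uniqueDiffOn_Icc zero_lt_one) (by norm_num))

theorem hasDerivAt_u (hp : 1 < p) {r : ℝ} (hr : r ∈ Ioo (0 : ℝ) 1) :
    HasDerivAt (F.u p) (F.flux p r / r) r := by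
  have hn : Icc (0 : ℝ) 1 ∈ nhds r := Icc_mem_nhds hr.1 hr.2
  have hd : DifferentiableAt ℝ (F.u p) r :=
    ((F.smooth p hp).contDiffAt hn).differentiableAt (by norm_num)
  rw [flux, derivWithin_of_mem_nhds hn, mul_div_cancel_left₀ _ hr.1.ne']
  exact hd.hasDerivAt

theorem hasDerivAt_flux (hp : 1 < p) {r : ℝ} (hr : r ∈ Ioo (0 : ℝ) 1) :
    HasDerivAt (F.flux p) (-(r * (|F.u p r| ^ (p - 1) * F.u p r))) r := by
  have hn : Icc (0 : ℝ) 1 ∈ nhds r := Icc_mem_nhds hr.1 hr.2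
  have hd : DifferentiableAt ℝ (deriv (F.u p)) r :=
    (((F.smooth p hp).contDiffAt hn).derivWithin (m := 1)
      (by norm_num)).differentiableAt (by norm_num)
  have h1 : HasDerivAt (fun x => x * deriv (F.u p) x)
      (1 * deriv (F.u p) r + r * deriv (deriv (F.u p)) r) r :=
    (hasDerivAt_id r).mul hd.hasDerivAt
  have h2 : F.flux p =ᶠ[nhds r] fun x => x * deriv (F.u p) x := by
    filter_upwards [Ioo_mem_nhds hr.1 hr.2] with x hx
    rw [flux, derivWithin_of_mem_nhds (Icc_mem_nhds hx.1 hx.2)]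
  refine (h1.congr_of_eventuallyEq h2).congr_deriv ?_
  rw [← F.ode p hp r hr]
  have := hr.1.ne'
  field_simp
  ring

theorem inner_profile (hp : 1 < p) :
    PositiveDiscProfile p (F.rp p) (fun r => -F.u p r) (fun r => -F.flux p r) where
  one_lt := hp
  radius_pos := (F.rp_mem p hp).1
  continuousOn := ((F.continuousOn_u hp).mono (Icc_subset_Icc le_rfl (F.rp_mem p hp).2.le)).neg
  continuousOn_flux :=
    ((F.continuousOn_flux hp).mono (Icc_subset_Icc le_rfl (F.rp_mem p hp).2.le)).neg
  hasDerivAt r hr :=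
    (F.hasDerivAt_u hp ⟨hr.1, hr.2.trans (F.rp_mem p hp).2⟩).neg.congr_deriv (by ring)
  hasDerivAt_flux r hr := by
    refine (F.hasDerivAt_flux hp ⟨hr.1, hr.2.trans (F.rp_mem p hp).2⟩).neg.congr_deriv ?_
    have hneg := F.neg_in p hp r ⟨hr.1.le, hr.2⟩
    rw [abs_of_neg hneg, rpow_sub_one (neg_pos.2 hneg).ne']
    have := hneg.ne
    field_simp
  flux_zero := by simp [flux]
  pos r hr := neg_pos.2 (F.neg_in p hp r hr)
  boundary := by simp [F.rp_zero p hp]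
  le_center r hr :=
    neg_le_neg (F.min_at_zero p hp r ⟨hr.1, hr.2.trans (F.rp_mem p hp).2.le⟩)

theorem outer_flux_bound (hp : 1 < p) :
    0 < F.flux p (F.rp p) ∧
      F.flux p (F.rp p) ≤ (F.flux p (F.rp p) * log (1 / F.rp p)) ^ p := by
  obtain ⟨hR0, hR1⟩ := F.rp_mem p hp
  refine annulus_flux_bound hp hR0 hR1
    ((F.continuousOn_u hp).mono (Icc_subset_Icc hR0.le le_rfl))
    ((F.continuousOn_flux hp).mono (Icc_subset_Icc hR0.le le_rfl))
    (fun r hr => F.hasDerivAt_u hp ⟨hR0.trans hr.1, hr.2⟩) (fun r hr => ?_)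
    (F.rp_zero p hp) (F.boundary p hp) (F.pos_out p hp)
  refine (F.hasDerivAt_flux hp ⟨hR0.trans hr.1, hr.2⟩).congr_deriv ?_
  have hpos := F.pos_out p hp r hr
  rw [abs_of_pos hpos, rpow_sub_one hpos.ne', div_mul_cancel₀ _ hpos.ne']

/-- If the nodal radius is at least `δ`, then `p` is bounded in terms of `δ`. -/
theorem exponent_bound (hp : 2 ≤ p) {δ : ℝ} (hδ : 0 < δ) (hR : δ ≤ F.rp p) :
    p ≤ 4 * exp 8 / δ ^ 4 := by
  have hp1 : 1 < p := by linarith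
  obtain ⟨hR0, hR1⟩ := F.rp_mem p hp1
  have hδ1 : δ < 1 := hR.trans_lt hR1
  have hM := (F.inner_profile hp1).center_pos
  have hheight := (F.inner_profile hp1).height_bound
  have hflux := (F.inner_profile hp1).flux_bound
  obtain ⟨hα, hout⟩ := F.outer_flux_bound hp1
  simp only [neg_neg] at hM hheight hflux
  set M := -F.u p 0
  set α := F.flux p (F.rp p)
  set R := F.rp p
  have hδi : 1 ≤ 1 / δ := by rw [le_div_iff₀ hδ]; linarith
  have hMle : M ≤ exp 8 / δ ^ 2 := by
    refine (rpow_le_rpow_iff (z := p - 1) hM.le (by positivity) (by linarith)).1 ?_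
    have h1 : δ ^ 2 * M ^ (p - 1) ≤ exp (4 * p) := by
      have hMp : 0 < M ^ (p - 1) := rpow_pos_of_pos hM _
      have h2 : 2 * (δ ^ 2 * M ^ (p - 1)) ≤ p * (R ^ 2 * M ^ (p - 1)) := by gcongr
      linarith
    have h3 : exp (4 * p) ≤ exp 8 ^ (p - 1) := by
      rw [← exp_mul]
      exact exp_le_exp.2 (by linarith)
    have h4 : (δ ^ 2) ^ (p - 1) ≤ δ ^ 2 := by
      simpa using rpow_le_rpow_of_exponent_ge (x := δ ^ 2) (by positivity)
        (by nlinarith) (by linarith : (1 : ℝ) ≤ p - 1)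
    rw [div_rpow (exp_pos 8).le (by positivity), le_div_iff₀ (by positivity)]
    calc M ^ (p - 1) * (δ ^ 2) ^ (p - 1) ≤ M ^ (p - 1) * δ ^ 2 := by gcongr
      _ ≤ exp 8 ^ (p - 1) := by linarith
  have hlog0 : 0 ≤ log (1 / R) := log_nonneg (by rw [le_div_iff₀ hR0]; linarith)
  have hlog : log (1 / R) ≤ 1 / δ :=
    (log_le_self (by positivity)).trans (one_div_le_one_div_of_le hδ hR)
  have hαle : 1 ≤ α * (1 / δ) ^ 2 := by
    by_contra! hlt
    have h1 : α ≤ (α * (1 / δ)) ^ p :=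
      hout.trans (rpow_le_rpow (by positivity) (by gcongr) (by linarith))
    have h2 : (α * (1 / δ)) ^ p = α * (α ^ (p - 1) * (1 / δ) ^ p) := by
      rw [mul_rpow hα.le (by positivity), rpow_sub_one hα.ne']
      field_simp
    have h3 : 1 ≤ α ^ (p - 1) * (1 / δ) ^ p := by
      rw [h2] at h1
      exact le_of_mul_le_mul_left (by linarith) hα
    have h4 : (1 / δ) ^ p ≤ ((1 / δ) ^ 2) ^ (p - 1) := by
      rw [← rpow_natCast_mul (by positivity)]
      exact rpow_le_rpow_of_exponent_le hδi (by push_cast; linarith)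
    have h5 : α ^ (p - 1) * (1 / δ) ^ p ≤ (α * (1 / δ) ^ 2) ^ (p - 1) := by
      rw [mul_rpow hα.le (by positivity)]
      gcongr
    have h6 : (α * (1 / δ) ^ 2) ^ (p - 1) < 1 :=
      rpow_lt_one (by positivity) hlt (by linarith)
    linarith
  have hα2 : δ ^ 2 ≤ α := by
    rw [one_div, inv_pow, ← div_eq_mul_inv, le_div_iff₀ (by positivity)] at hαle
    linarith
  rw [le_div_iff₀ (by positivity)] at hflux hMle ⊢
  have hδp : p * δ ^ 2 ≤ 4 * M := by
    nlinarith [mul_le_mul_of_nonneg_right hα2 (by linarith : 0 ≤ p + 1), sq_nonneg δ]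
  nlinarith [mul_le_mul_of_nonneg_right hδp (sq_nonneg δ)]

end LaneEmdenFamily

/-- The radius `r_p` of the nodal circle of `u_p` tends to `0`
as `p → +∞`. -/
theorem nodal_radius_tendsto_zero (F : LaneEmdenFamily) :
    Tendsto F.rp atTop (nhds 0) := by
  rw [Metric.tendsto_atTop]
  intro δ hδ
  refine ⟨max 2 (4 * exp 8 / δ ^ 4 + 1), fun p hp => ?_⟩
  have hp2 : 2 ≤ p := (le_max_left _ _).trans hp
  have hpb : 4 * exp 8 / δ ^ 4 + 1 ≤ p := (le_max_right _ _).trans hp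
  rw [Real.dist_0_eq_abs, abs_of_pos (F.rp_mem p (by linarith)).1]
  by_contra! hR
  linarith [F.exponent_bound hp2 hδ hR]
end
end

section
/- Define z_p⁻ : B(0, r_p/ε_p⁻) → ℝ by z_p⁻(x) = −(p/‖u_p⁻‖_∞)·(u_p⁻(ε_p⁻|x|) + u_p(0)). Then r_p/ε_p⁻ → +∞ as p → +∞, and z_p⁻ converges to −U in C¹_loc(ℝ²) as p → +∞, where U(x) = log(1/(1 + |x|²/8)²). -/
open Real MeasureTheory Set Filter

noncomputable section

/-- The plane `ℝ²`. -/
abbrev E2 := EuclideanSpace ℝ (Fin 2)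

/-- The unique regular solution `U(x) = log(1/(1+|x|²/8)²)` of the Liouville equation
`−ΔU = e^U` in `ℝ²` with `∫ e^U < ∞`, `U(0) = 0`, `∇U(0) = 0`. -/
def Uliouville (x : E2) : ℝ := Real.log (1 / (1 + ‖x‖ ^ 2 / 8) ^ 2)

/-- The rescaling `z_p⁻(x) = −(p/‖u_p⁻‖_∞)·(u_p⁻(ε_p⁻|x|) + u_p(0))` of the negative
part `u_p⁻ = max(−u_p, 0)`, with `‖u_p⁻‖_∞ = −u_p(0)`. -/
def zMinus (F : LaneEmdenFamily) (p : ℝ) (x : E2) : ℝ :=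
  -(p / (-F.u p 0)) * ((max (-F.u p (epsM F p * ‖x‖)) 0) + F.u p 0)

/-- The radial profile `2 log(1 + s²/8)` of `-U`. -/
def liouvilleProfile (s : ℝ) : ℝ := 2 * Real.log (1 + s ^ 2 / 8)

/-- The derivative of `liouvilleProfile`. -/
def liouvilleSlope (s : ℝ) : ℝ := (s / 2) / (1 + s ^ 2 / 8)

lemma neg_Uliouville (x : E2) : -Uliouville x = liouvilleProfile ‖x‖ := by
  simp [Uliouville, liouvilleProfile, Real.log_pow]

lemma hasDerivAt_liouvilleProfile (s : ℝ) :
    HasDerivAt liouvilleProfile (liouvilleSlope s) s := by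
  have hpos : 1 + s ^ 2 / 8 ≠ 0 := by positivity
  have h1 : HasDerivAt (fun s : ℝ => 1 + s ^ 2 / 8) (s / 4) s := by
    have := ((hasDerivAt_pow 2 s).div_const 8).const_add 1
    refine this.congr_deriv ?_
    norm_num
    ring
  refine ((h1.log hpos).const_mul 2).congr_deriv ?_
  unfold liouvilleSlope
  field_simp
  ring

lemma exp_neg_liouvilleProfile (s : ℝ) :
    Real.exp (-liouvilleProfile s) = 1 / (1 + s ^ 2 / 8) ^ 2 := by
  have hpos : 0 < 1 + s ^ 2 / 8 := by positivity
  have : -liouvilleProfile s = Real.log (1 / (1 + s ^ 2 / 8) ^ 2) := by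
    simp [liouvilleProfile, Real.log_pow]
  rw [this, Real.exp_log (by positivity)]

lemma hasDerivAt_liouvilleSlope {s : ℝ} (hs : s ≠ 0) :
    HasDerivAt liouvilleSlope
      (Real.exp (-liouvilleProfile s) - liouvilleSlope s / s) s := by
  have hpos : 1 + s ^ 2 / 8 ≠ 0 := by positivity
  have h1 : HasDerivAt (fun s : ℝ => 1 + s ^ 2 / 8) (s / 4) s := by
    have := ((hasDerivAt_pow 2 s).div_const 8).const_add 1
    refine this.congr_deriv ?_
    norm_num
    ring
  refine (((hasDerivAt_id s).div_const 2).div h1 hpos).congr_deriv ?_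
  rw [exp_neg_liouvilleProfile]
  unfold liouvilleSlope
  simp only [id]
  field_simp
  ring

lemma liouvilleProfile_nonneg (s : ℝ) : 0 ≤ liouvilleProfile s :=
  mul_nonneg zero_le_two (Real.log_nonneg (by nlinarith [sq_nonneg s]))

lemma liouvilleProfile_le (s : ℝ) : liouvilleProfile s ≤ s ^ 2 / 4 := by
  have := Real.log_le_sub_one_of_pos (show 0 < 1 + s ^ 2 / 8 by positivity)
  unfold liouvilleProfile
  linarith

/-- A Grönwall estimate for the radial equation `h'' + h'/s = f` with `|f| ≤ δ + |h|`. -/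
lemma radial_gronwall {h h' f : ℝ → ℝ} {δ M : ℝ}
    (hc : ContinuousOn h (Icc 0 M)) (hc' : ContinuousOn h' (Icc 0 M))
    (hd : ∀ s ∈ Ioo 0 M, HasDerivAt h (h' s) s)
    (hd' : ∀ s ∈ Ioo 0 M, HasDerivAt h' (f s - h' s / s) s)
    (hf : ∀ s ∈ Ioo 0 M, |f s| ≤ δ + |h s|) (h0 : h 0 = 0) (h0' : h' 0 = 0) :
    ∀ s ∈ Icc 0 M, h s ^ 2 + h' s ^ 2 ≤ δ ^ 2 * Real.exp (3 * M) := by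
  intro s hs
  have hder : ∀ t ∈ Ioo 0 M, HasDerivAt
      (fun t => (h t ^ 2 + h' t ^ 2 + δ ^ 2 / 3) * Real.exp (-3 * t))
      ((2 * h t * h' t + 2 * h' t * (f t - h' t / t)
        - 3 * (h t ^ 2 + h' t ^ 2 + δ ^ 2 / 3)) * Real.exp (-3 * t)) t := by
    intro t ht
    have he : HasDerivAt (fun t : ℝ => Real.exp (-3 * t)) (Real.exp (-3 * t) * (-3 * 1)) t :=
      ((hasDerivAt_id t).const_mul (-3)).exp
    refine ((((hd t ht).pow 2).add ((hd' t ht).pow 2)).add_const (δ ^ 2 / 3) |>.mul he).congr_deriv ?_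
    simp only [Pi.add_apply, Pi.pow_apply]
    push_cast
    ring
  have hanti : AntitoneOn
      (fun t => (h t ^ 2 + h' t ^ 2 + δ ^ 2 / 3) * Real.exp (-3 * t)) (Icc 0 M) := by
    refine antitoneOn_of_deriv_nonpos (convex_Icc 0 M) (by fun_prop) ?_ ?_
    · rw [interior_Icc]
      exact fun t ht => (hder t ht).differentiableAt.differentiableWithinAt
    · rw [interior_Icc]
      intro t ht
      rw [(hder t ht).deriv]
      refine mul_nonpos_of_nonpos_of_nonneg ?_ (Real.exp_pos _).le
      have h1 : 0 ≤ h' t * (h' t / t) := by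
        rw [← mul_div_assoc]
        exact div_nonneg (mul_self_nonneg _) ht.1.le
      have h2 : h' t * f t ≤ |h' t| * (δ + |h t|) := by
        refine (le_abs_self _).trans ?_
        rw [abs_mul]
        exact mul_le_mul_of_nonneg_left (hf t ht) (abs_nonneg _)
      nlinarith [sq_nonneg (|h' t| - δ), sq_nonneg (|h' t| - |h t|), sq_nonneg (h t - h' t),
        sq_abs (h t), sq_abs (h' t)]
  have hM : (0 : ℝ) ≤ M := hs.1.trans hs.2
  have key := hanti ⟨le_rfl, hM⟩ hs hs.1
  simp only [h0, h0', mul_zero, Real.exp_zero, mul_one] at key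
  have hexp : Real.exp (-3 * s) * Real.exp (3 * s) = 1 := by
    rw [← Real.exp_add]
    simp
  have hmono : Real.exp (3 * s) ≤ Real.exp (3 * M) := Real.exp_le_exp.2 (by linarith [hs.2])
  have h3 := mul_le_mul_of_nonneg_right key (Real.exp_pos (3 * s)).le
  rw [mul_assoc, hexp] at h3
  nlinarith [mul_le_mul_of_nonneg_left hmono (sq_nonneg δ), sq_nonneg δ, Real.exp_pos (3 * s)]

/-- If `z'' + z'/s ≤ 1` with `z(0) = z'(0) = 0` then `z ≤ s²/4`. -/
lemma radial_le_sq_div_four {z z' f : ℝ → ℝ} {M : ℝ}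
    (hc : ContinuousOn z (Icc 0 M)) (hc' : ContinuousOn z' (Icc 0 M))
    (hd : ∀ s ∈ Ioo 0 M, HasDerivAt z (z' s) s)
    (hd' : ∀ s ∈ Ioo 0 M, HasDerivAt z' (f s - z' s / s) s)
    (hf : ∀ s ∈ Ioo 0 M, f s ≤ 1) (h0 : z 0 = 0) :
    ∀ s ∈ Icc 0 M, z s ≤ s ^ 2 / 4 := by
  have hder : ∀ t ∈ Ioo 0 M, HasDerivAt (fun t => t * z' t - t ^ 2 / 2) (t * (f t - 1)) t := by
    intro t ht
    refine (((hasDerivAt_id t).mul (hd' t ht)).sub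
      ((hasDerivAt_pow 2 t).div_const 2)).congr_deriv ?_
    have := ht.1.ne'
    simp only [id]
    field_simp
    ring
  have hanti : AntitoneOn (fun t => t * z' t - t ^ 2 / 2) (Icc 0 M) := by
    refine antitoneOn_of_deriv_nonpos (convex_Icc 0 M) (by fun_prop) ?_ ?_
    · rw [interior_Icc]
      exact fun t ht => (hder t ht).differentiableAt.differentiableWithinAt
    · rw [interior_Icc]
      intro t ht
      rw [(hder t ht).deriv]
      nlinarith [ht.1, hf t ht]
  have hder2 : ∀ t ∈ Ioo 0 M, HasDerivAt (fun t => z t - t ^ 2 / 4) (z' t - t / 2) t := by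
    intro t ht
    refine ((hd t ht).sub ((hasDerivAt_pow 2 t).div_const 4)).congr_deriv ?_
    norm_num
    ring
  have hanti2 : AntitoneOn (fun t => z t - t ^ 2 / 4) (Icc 0 M) := by
    refine antitoneOn_of_deriv_nonpos (convex_Icc 0 M) (by fun_prop) ?_ ?_
    · rw [interior_Icc]
      exact fun t ht => (hder2 t ht).differentiableAt.differentiableWithinAt
    · rw [interior_Icc]
      intro t ht
      rw [(hder2 t ht).deriv]
      have h1 := hanti ⟨le_rfl, ht.1.le.trans ht.2.le⟩ (Ioo_subset_Icc_self ht) ht.1.le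
      simp only at h1
      have h2 : t * (z' t - t / 2) ≤ t * 0 := by nlinarith
      exact le_of_mul_le_mul_left h2 ht.1
  intro s hs
  have h1 := hanti2 ⟨le_rfl, hs.1.trans hs.2⟩ hs hs.1
  simp only [h0] at h1
  linarith

/-- `(1 - x/p)^p` approximates `e^{-x}` to order `1/p`, uniformly in `x ∈ [0, p]`. -/
lemma abs_one_sub_div_rpow_sub_exp_neg_le {p x : ℝ} (hp : 1 ≤ p) (hx : 0 ≤ x) (hxp : x ≤ p) :
    |(1 - x / p) ^ p - Real.exp (-x)| ≤ 2 / p := by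
  have hp0 : 0 < p := by linarith
  set y := x / p with hy
  have hxy : x = p * y := by rw [hy]; field_simp
  have hy0 : 0 ≤ y := by positivity
  have hy1 : y ≤ 1 := (div_le_one hp0).2 hxp
  have hE : Real.exp (-y) ^ p = Real.exp (-x) := by
    rw [← Real.exp_mul, hxy]
    ring_nf
  have upper : (1 - y) ^ p ≤ Real.exp (-x) := by
    rw [← hE]
    exact Real.rpow_le_rpow (by linarith) (by linarith [Real.add_one_le_exp (-y)]) hp0.le
  have h1 : Real.exp (-y) * (1 - y ^ 2) ≤ 1 - y := by
    have h2 : Real.exp (-y) * (1 + y) ≤ 1 := by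
      have := Real.add_one_le_exp y
      calc Real.exp (-y) * (1 + y) ≤ Real.exp (-y) * Real.exp y :=
            mul_le_mul_of_nonneg_left (by linarith) (Real.exp_pos _).le
        _ = 1 := by rw [← Real.exp_add]; simp
    nlinarith
  have hy2 : 0 ≤ 1 - y ^ 2 := by nlinarith
  have lower : Real.exp (-x) * (1 - p * y ^ 2) ≤ (1 - y) ^ p := by
    have hb : 1 + p * (-y ^ 2) ≤ (1 + -y ^ 2) ^ p :=
      one_add_mul_self_le_rpow_one_add (by linarith) hp
    calc Real.exp (-x) * (1 - p * y ^ 2) ≤ Real.exp (-x) * (1 - y ^ 2) ^ p := by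
          refine mul_le_mul_of_nonneg_left ?_ (Real.exp_pos _).le
          simpa [sub_eq_add_neg] using hb
      _ = (Real.exp (-y) * (1 - y ^ 2)) ^ p := by
          rw [Real.mul_rpow (Real.exp_pos _).le hy2, hE]
      _ ≤ (1 - y) ^ p := Real.rpow_le_rpow (by positivity) h1 hp0.le
  have hsq : Real.exp (-x) * x ^ 2 ≤ 2 := by
    have := Real.quadratic_le_exp_of_nonneg hx
    have h3 : Real.exp (-x) * Real.exp x = 1 := by rw [← Real.exp_add]; simp
    nlinarith [Real.exp_pos (-x)]
  have hfin : Real.exp (-x) * (p * y ^ 2) ≤ 2 / p := by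
    rw [le_div_iff₀ hp0]
    calc Real.exp (-x) * (p * y ^ 2) * p = Real.exp (-x) * x ^ 2 := by rw [hxy]; ring
      _ ≤ 2 := hsq
  rw [abs_le]
  constructor
  · nlinarith
  · have : 0 ≤ 2 / p := by positivity
    linarith

lemma abs_exp_neg_sub_exp_neg_le {a b : ℝ} (ha : 0 ≤ a) (hb : 0 ≤ b) :
    |Real.exp (-a) - Real.exp (-b)| ≤ |a - b| := by
  wlog hab : a ≤ b generalizing a b
  · rw [abs_sub_comm, abs_sub_comm a]
    exact this hb ha (le_of_not_ge hab)
  have h1 : Real.exp (-b) ≤ Real.exp (-a) := Real.exp_le_exp.2 (by linarith)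
  rw [abs_of_nonneg (by linarith), abs_of_nonpos (by linarith)]
  have h2 : Real.exp (-b) = Real.exp (-a) * Real.exp (-(b - a)) := by
    rw [← Real.exp_add]; ring_nf
  have h3 := Real.add_one_le_exp (-(b - a))
  have h4 : Real.exp (-a) ≤ 1 := Real.exp_le_one_iff.2 (by linarith)
  nlinarith [Real.exp_pos (-a)]

/-- The gradient of a radial function with profile bounded by `s²/4` vanishes at the origin. -/
lemma hasFDerivAt_zero_of_radial_le {g : E2 → ℝ} {z : ℝ → ℝ} {R : ℝ} (hR : 0 < R)
    (hg : ∀ x : E2, ‖x‖ < R → g x = z ‖x‖)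
    (hz : ∀ s ∈ Ico 0 R, 0 ≤ z s ∧ z s ≤ s ^ 2 / 4) :
    HasFDerivAt g (0 : E2 →L[ℝ] ℝ) 0 := by
  refine Asymptotics.IsBigO.hasFDerivAt (n := 2) ?_ one_lt_two
  refine Asymptotics.IsBigO.of_bound 1 ?_
  filter_upwards [Metric.ball_mem_nhds (0 : E2) hR] with x hx
  have hx' : ‖x‖ < R := by simpa using hx
  have := hz ‖x‖ ⟨norm_nonneg _, hx'⟩
  rw [hg x hx', Real.norm_eq_abs, abs_of_nonneg this.1]
  simp only [sub_zero, norm_pow, norm_norm]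
  nlinarith [this.2, sq_nonneg ‖x‖]

/-- Distance between the gradients of two radial functions away from the origin. -/
lemma norm_fderiv_radial_sub_le {f g : E2 → ℝ} {z w : ℝ → ℝ} {a b : ℝ} {x : E2} (hx : x ≠ 0)
    (hf : f =ᶠ[nhds x] fun y => z ‖y‖) (hg : g =ᶠ[nhds x] fun y => w ‖y‖)
    (hz : HasDerivAt z a ‖x‖) (hw : HasDerivAt w b ‖x‖) :
    ‖fderiv ℝ f x - fderiv ℝ g x‖ ≤ |a - b| := by
  have hn : HasFDerivAt (fun y : E2 => ‖y‖) (fderiv ℝ (fun y : E2 => ‖y‖) x) x :=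
    (differentiableAt_id.norm ℝ hx).hasFDerivAt
  have h1 := hz.comp_hasFDerivAt x hn
  have h2 := hw.comp_hasFDerivAt x hn
  rw [hf.fderiv_eq, hg.fderiv_eq]
  change ‖fderiv ℝ (z ∘ fun y : E2 => ‖y‖) x - fderiv ℝ (w ∘ fun y : E2 => ‖y‖) x‖ ≤ _
  rw [h1.fderiv, h2.fderiv, ← sub_smul, norm_smul, Real.norm_eq_abs]
  have : ‖fderiv ℝ (fun y : E2 => ‖y‖) x‖ ≤ ((1 : NNReal) : ℝ) :=
    norm_fderiv_le_of_lipschitz ℝ lipschitzWith_one_norm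
  exact mul_le_of_le_one_right (abs_nonneg _) (by simpa using this)

/-- A solution of `-u'' - u'/r = f` that is `C²` up to `r = 0`, with `f` continuous, has
one-sided derivative zero at the origin; the derivative itself satisfies the first-order system. -/
lemma exists_radial_derivative {u f : ℝ → ℝ} (hu : ContDiffOn ℝ 2 u (Icc (0:ℝ) 1))
    (hf : ContinuousOn f (Icc (0:ℝ) 1))
    (hode : ∀ r ∈ Ioo (0:ℝ) 1, -deriv (deriv u) r - deriv u r / r = f r) :
    ∃ d : ℝ → ℝ, ContinuousOn d (Icc 0 1) ∧ d 0 = 0 ∧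
      (∀ r ∈ Ioo (0:ℝ) 1, HasDerivAt u (d r) r) ∧
      ∀ r ∈ Ioo (0:ℝ) 1, HasDerivAt d (-f r - d r / r) r := by
  have hU : UniqueDiffOn ℝ (Icc (0:ℝ) 1) := uniqueDiffOn_Icc one_pos
  set d := derivWithin u (Icc (0:ℝ) 1) with hddef
  have hd1 : ContDiffOn ℝ 1 d (Icc 0 1) := hu.derivWithin hU (by norm_num)
  have hd2 : ContDiffOn ℝ 0 (derivWithin d (Icc (0:ℝ) 1)) (Icc 0 1) :=
    hd1.derivWithin hU (by norm_num)
  have hmem : ∀ r ∈ Ioo (0:ℝ) 1, Icc (0:ℝ) 1 ∈ nhds r := fun r hr => Icc_mem_nhds hr.1 hr.2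
  have hdu : ∀ r ∈ Ioo (0:ℝ) 1, d r = deriv u r := fun r hr => derivWithin_of_mem_nhds (hmem r hr)
  have hud : ∀ r ∈ Ioo (0:ℝ) 1, HasDerivAt u (d r) r := by
    intro r hr
    rw [hdu r hr]
    exact ((hu.differentiableOn (by norm_num)).differentiableAt (hmem r hr)).hasDerivAt
  have hdd : ∀ r ∈ Ioo (0:ℝ) 1, HasDerivAt d (-f r - d r / r) r := by
    intro r hr
    have h1 : d =ᶠ[nhds r] deriv u := by
      filter_upwards [isOpen_Ioo.mem_nhds hr] with t ht using hdu t ht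
    have h2 : HasDerivAt d (deriv d r) r :=
      ((hd1.differentiableOn (by norm_num)).differentiableAt (hmem r hr)).hasDerivAt
    refine h2.congr_deriv ?_
    rw [h1.deriv_eq, hdu r hr]
    linarith [hode r hr]
  refine ⟨d, hd1.continuousOn, ?_, hud, hdd⟩
  have heq : EqOn d (fun r => r * (-f r - derivWithin d (Icc (0:ℝ) 1) r)) (Ioo 0 1) := by
    intro r hr
    have h1 : derivWithin d (Icc (0:ℝ) 1) r = -f r - d r / r := by
      rw [derivWithin_of_mem_nhds (hmem r hr), (hdd r hr).deriv]
    have := hr.1.ne'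
    simp only [h1]
    field_simp
    ring
  have hcl : EqOn d (fun r => r * (-f r - derivWithin d (Icc (0:ℝ) 1) r)) (Icc 0 1) := by
    refine heq.of_subset_closure hd1.continuousOn ?_ Ioo_subset_Icc_self ?_
    · exact continuousOn_id.mul (hf.neg.sub hd2.continuousOn)
    · rw [closure_Ioo zero_ne_one]
  simpa using hcl (⟨le_rfl, zero_le_one⟩ : (0:ℝ) ∈ Icc (0:ℝ) 1)

lemma epsM_pos (F : LaneEmdenFamily) {p : ℝ} (hp : 1 < p) : 0 < epsM F p := by
  have := F.center_neg p hp
  have : 0 < (-F.u p 0) ^ (p - 1) := Real.rpow_pos_of_pos (by linarith) _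
  unfold epsM
  positivity

lemma epsM_sq_mul (F : LaneEmdenFamily) {p : ℝ} (hp : 1 < p) :
    epsM F p ^ 2 * (p * (-F.u p 0) ^ (p - 1)) = 1 := by
  have := F.center_neg p hp
  have : 0 < (-F.u p 0) ^ (p - 1) := Real.rpow_pos_of_pos (by linarith) _
  have hpos : 0 < p * (-F.u p 0) ^ (p - 1) := by positivity
  unfold epsM
  rw [div_pow, one_pow, Real.sq_sqrt hpos.le]
  field_simp

/-- The profile of `z_p⁻` solves `z'' + z'/s = (1 - z/p)^p` up to radius `r_p/ε_p⁻`,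
where it reaches the value `p`. -/
lemma exists_zMinus_profile (F : LaneEmdenFamily) {p : ℝ} (hp : 1 < p) :
    ∃ z z' : ℝ → ℝ,
      (∀ x : E2, ‖x‖ < F.rp p / epsM F p → zMinus F p x = z ‖x‖) ∧
      ContinuousOn z (Icc 0 (F.rp p / epsM F p)) ∧
      ContinuousOn z' (Icc 0 (F.rp p / epsM F p)) ∧
      (∀ s ∈ Ioo 0 (F.rp p / epsM F p), HasDerivAt z (z' s) s) ∧
      (∀ s ∈ Ioo 0 (F.rp p / epsM F p),
        HasDerivAt z' ((1 - z s / p) ^ p - z' s / s) s) ∧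
      z 0 = 0 ∧ z' 0 = 0 ∧ z (F.rp p / epsM F p) = p ∧
      ∀ s ∈ Icc 0 (F.rp p / epsM F p), 0 ≤ z s ∧ z s ≤ p := by
  have hε := epsM_pos F hp
  have hε2 := epsM_sq_mul F hp
  set ε := epsM F p with hεdef
  set m := -F.u p 0 with hm
  have hm0 : 0 < m := by linarith [F.center_neg p hp]
  have hp0 : 0 < p := by linarith
  obtain ⟨hr0, hr1⟩ := F.rp_mem p hp
  have hcu : ContinuousOn (F.u p) (Icc 0 1) := (F.smooth p hp).continuousOn
  have hcf : ContinuousOn (fun r => |F.u p r| ^ (p - 1) * F.u p r) (Icc 0 1) :=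
    (hcu.abs.rpow_const fun _ _ => Or.inr (by linarith)).mul hcu
  obtain ⟨d, hdc, hd0, hud, hdd⟩ := exists_radial_derivative (F.smooth p hp) hcf (F.ode p hp)
  have hscale : ∀ s ∈ Icc 0 (F.rp p / ε), ε * s ∈ Icc 0 (F.rp p) := by
    intro s hs
    refine ⟨mul_nonneg hε.le hs.1, ?_⟩
    have := (le_div_iff₀ hε).1 hs.2
    linarith
  have hscale' : ∀ s ∈ Ioo 0 (F.rp p / ε), ε * s ∈ Ioo 0 (F.rp p) := by
    intro s hs
    refine ⟨mul_pos hε hs.1, ?_⟩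
    have := (lt_div_iff₀ hε).1 hs.2
    linarith
  have hsub : ∀ r ∈ Icc 0 (F.rp p), r ∈ Icc (0:ℝ) 1 := fun r hr => ⟨hr.1, hr.2.trans hr1.le⟩
  have hnonpos : ∀ r ∈ Icc 0 (F.rp p), F.u p r ≤ 0 := by
    intro r hr
    rcases hr.2.lt_or_eq with h | h
    · exact (F.neg_in p hp r ⟨hr.1, h⟩).le
    · rw [h, F.rp_zero p hp]
  have hmul : ∀ s : ℝ, HasDerivAt (fun s => ε * s) ε s := fun s => by
    simpa using (hasDerivAt_id s).const_mul ε
  refine ⟨fun s => p / m * (F.u p (ε * s) + m), fun s => p / m * (ε * d (ε * s)),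
    ?_, ?_, ?_, ?_, ?_, ?_, ?_, ?_, ?_⟩
  · intro x hx
    have h1 := hnonpos _ (hscale ‖x‖ ⟨norm_nonneg _, hx.le⟩)
    unfold zMinus
    rw [← hεdef, max_eq_left (by linarith), ← hm]
    have : F.u p 0 = -m := by rw [hm]; ring
    rw [this]
    ring
  · refine continuousOn_const.mul (ContinuousOn.add ?_ continuousOn_const)
    exact hcu.comp (by fun_prop) fun s hs => hsub _ (hscale s hs)
  · refine continuousOn_const.mul (continuousOn_const.mul ?_)
    exact hdc.comp (by fun_prop) fun s hs => hsub _ (hscale s hs)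
  · intro s hs
    have h1 := hscale' s hs
    have h2 := (hud (ε * s) ⟨h1.1, h1.2.trans hr1⟩).comp s (hmul s)
    refine ((h2.add_const m).const_mul (p / m)).congr_deriv ?_
    ring
  · intro s hs
    have h1 := hscale' s hs
    have h2 := (hdd (ε * s) ⟨h1.1, h1.2.trans hr1⟩).comp s (hmul s)
    refine ((h2.const_mul ε).const_mul (p / m)).congr_deriv ?_
    have hneg : F.u p (ε * s) < 0 := F.neg_in p hp _ ⟨h1.1.le, h1.2⟩
    set v := -F.u p (ε * s) with hv
    have hv0 : 0 < v := by linarith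
    have huv : F.u p (ε * s) = -v := by rw [hv]; ring
    have hs0 := hs.1.ne'
    have e1 : 1 - p / m * (-v + m) / p = v / m := by
      field_simp
      ring
    have e2 : v ^ (p - 1) * v = v ^ p := by
      rw [Real.rpow_sub_one hv0.ne']
      field_simp
    have e3 : m ^ (p - 1) * m = m ^ p := by
      rw [Real.rpow_sub_one hm0.ne']
      field_simp
    have hmp : 0 < m ^ p := Real.rpow_pos_of_pos hm0 _
    have e4 : p / m * ε ^ 2 = 1 / m ^ p := by
      rw [← e3]
      have : m ^ (p - 1) ≠ 0 := (Real.rpow_pos_of_pos hm0 _).ne'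
      field_simp
      linarith
    simp only [huv, abs_neg, abs_of_pos hv0]
    rw [e1, Real.div_rpow hv0.le hm0.le]
    calc p / m * (ε * ((-(v ^ (p - 1) * -v) - d (ε * s) / (ε * s)) * ε))
        = p / m * ε ^ 2 * (v ^ (p - 1) * v) - p / m * (ε * d (ε * s)) / s := by
          field_simp
      _ = _ := by rw [e2, e4]; ring
  · simp [hm]
  · simp [hd0]
  · have : ε * (F.rp p / ε) = F.rp p := by field_simp
    simp only [this, F.rp_zero p hp]
    field_simp
    ring
  · intro s hs
    have h1 := hscale s hs
    have h2 := F.min_at_zero p hp _ (hsub _ h1)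
    have h3 := hnonpos _ h1
    constructor
    · exact mul_nonneg (by positivity) (by linarith)
    · change p / m * (F.u p (ε * s) + m) ≤ p
      rw [div_mul_eq_mul_div, div_le_iff₀ hm0]
      exact mul_le_mul_of_nonneg_left (by linarith) hp0.le

/-- Quantitative `C¹` closeness of `z_p⁻` to `-U` on a ball, with the lower bound on the
rescaled nodal radius. -/
lemma zMinus_estimates (F : LaneEmdenFamily) {p : ℝ} (hp : 1 < p) :
    2 * Real.sqrt p ≤ F.rp p / epsM F p ∧
    ∀ M < F.rp p / epsM F p, ∀ x : E2, ‖x‖ < M →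
      |zMinus F p x - -Uliouville x| ≤ 2 / p * Real.exp (3 * M / 2) ∧
      ‖fderiv ℝ (zMinus F p) x - fderiv ℝ (fun y => -Uliouville y) x‖
        ≤ 2 / p * Real.exp (3 * M / 2) := by
  obtain ⟨z, z', hz, hc, hc', hd, hd', h0, h0', hR, hb⟩ := exists_zMinus_profile F hp
  have hp0 : 0 < p := by linarith
  have hRpos : 0 < F.rp p / epsM F p := div_pos (F.rp_mem p hp).1 (epsM_pos F hp)
  set R := F.rp p / epsM F p
  have hle : ∀ s ∈ Icc 0 R, z s ≤ s ^ 2 / 4 := by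
    refine radial_le_sq_div_four hc hc' hd hd' ?_ h0
    intro s hs
    have h1 := hb s (Ioo_subset_Icc_self hs)
    have h2 : 0 ≤ z s / p := div_nonneg h1.1 hp0.le
    have h3 : z s / p ≤ 1 := (div_le_one hp0).2 h1.2
    exact Real.rpow_le_one (by linarith) (by linarith) hp0.le
  constructor
  · have h1 := hle R ⟨hRpos.le, le_rfl⟩
    rw [hR] at h1
    refine le_of_sq_le_sq ?_ hRpos.le
    rw [mul_pow, Real.sq_sqrt hp0.le]
    linarith
  intro M hM x hx
  have hM0 : 0 < M := (norm_nonneg x).trans_lt hx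
  have hsub : Icc 0 M ⊆ Icc 0 R := Icc_subset_Icc_right hM.le
  have hsub' : Ioo 0 M ⊆ Ioo 0 R := Ioo_subset_Ioo_right hM.le
  have hwc : Continuous liouvilleProfile :=
    continuous_iff_continuousAt.2 fun s => (hasDerivAt_liouvilleProfile s).continuousAt
  have hwc' : Continuous liouvilleSlope := by
    unfold liouvilleSlope
    refine Continuous.div (by fun_prop) (by fun_prop) fun s => by positivity
  have hgr := radial_gronwall (h := fun s => z s - liouvilleProfile s)
    (h' := fun s => z' s - liouvilleSlope s) (δ := 2 / p) (M := M)
    (f := fun s => (1 - z s / p) ^ p - Real.exp (-liouvilleProfile s))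
    ((hc.mono hsub).sub hwc.continuousOn) ((hc'.mono hsub).sub hwc'.continuousOn)
    (fun s hs => (hd s (hsub' hs)).sub (hasDerivAt_liouvilleProfile s))
    (fun s hs => ((hd' s (hsub' hs)).sub (hasDerivAt_liouvilleSlope hs.1.ne')).congr_deriv
      (by ring))
    (by
      intro s hs
      have h1 := hb s (hsub (Ioo_subset_Icc_self hs))
      exact (abs_sub_le _ (Real.exp (-z s)) _).trans (add_le_add
        (abs_one_sub_div_rpow_sub_exp_neg_le hp.le h1.1 h1.2)
        (abs_exp_neg_sub_exp_neg_le h1.1 (liouvilleProfile_nonneg s))))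
    (by simp [h0, liouvilleProfile]) (by simp [h0', liouvilleSlope])
    ‖x‖ ⟨norm_nonneg x, hx.le⟩
  have hsq : (2 / p) ^ 2 * Real.exp (3 * M) = (2 / p * Real.exp (3 * M / 2)) ^ 2 := by
    rw [mul_pow, ← Real.exp_nat_mul]
    congr 2
    push_cast
    ring
  rw [hsq] at hgr
  have hC : 0 ≤ 2 / p * Real.exp (3 * M / 2) := by positivity
  have hxR : ‖x‖ < R := hx.trans hM
  constructor
  · rw [hz x hxR, neg_Uliouville]
    refine abs_le_of_sq_le_sq ?_ hC
    linarith [sq_nonneg (z' ‖x‖ - liouvilleSlope ‖x‖)]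
  · by_cases hx0 : x = 0
    · subst hx0
      have h1 := hasFDerivAt_zero_of_radial_le hRpos hz
        fun s hs => ⟨(hb s (Ico_subset_Icc_self hs)).1, hle s (Ico_subset_Icc_self hs)⟩
      have h2 := hasFDerivAt_zero_of_radial_le hRpos (fun x _ => neg_Uliouville x)
        fun s _ => ⟨liouvilleProfile_nonneg s, liouvilleProfile_le s⟩
      rw [h1.fderiv, h2.fderiv]
      simpa using hC
    · have hs : ‖x‖ ∈ Ioo 0 R := ⟨norm_pos_iff.2 hx0, hxR⟩
      refine (norm_fderiv_radial_sub_le hx0 (z := z) ?_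
        (Filter.Eventually.of_forall neg_Uliouville) (hd _ hs)
        (hasDerivAt_liouvilleProfile _)).trans ?_
      · filter_upwards [(isOpen_lt continuous_norm continuous_const).mem_nhds hxR] with y hy
          using hz y hy
      · refine abs_le_of_sq_le_sq ?_ hC
        linarith [sq_nonneg (z ‖x‖ - liouvilleProfile ‖x‖)]

/-- `r_p/ε_p⁻ → +∞` and `z_p⁻ → −U` in `C¹_loc(ℝ²)` as `p → +∞`:
uniform convergence of the functions and of their derivatives on every compact set. -/
theorem zMinus_tendsto_liouville (F : LaneEmdenFamily) :
    Tendsto (fun p => F.rp p / epsM F p) atTop atTop ∧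
    ∀ K : Set E2, IsCompact K →
      TendstoUniformlyOn (fun p x => zMinus F p x) (fun x => -Uliouville x) atTop K ∧
      TendstoUniformlyOn (fun p x => fderiv ℝ (zMinus F p) x)
        (fun x => fderiv ℝ (fun y => -Uliouville y) x) atTop K := by
  have hrad : Tendsto (fun p => F.rp p / epsM F p) atTop atTop := by
    refine tendsto_atTop_mono' atTop ?_
      (Tendsto.const_mul_atTop (zero_lt_two' ℝ) Real.tendsto_sqrt_atTop)
    filter_upwards [eventually_gt_atTop 1] with p hp using (zMinus_estimates F hp).1
  refine ⟨hrad, fun K hK => ?_⟩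
  obtain ⟨M, hKM⟩ := hK.isBounded.subset_ball (0 : E2)
  have hlim : Tendsto (fun p : ℝ => 2 / p * Real.exp (3 * M / 2)) atTop (nhds 0) := by
    simpa using (tendsto_const_nhds.div_atTop tendsto_id).mul_const (Real.exp (3 * M / 2))
  have hest : ∀ η > 0, ∀ᶠ p in atTop, ∀ x ∈ K, |zMinus F p x - -Uliouville x| < η ∧
      ‖fderiv ℝ (zMinus F p) x - fderiv ℝ (fun y => -Uliouville y) x‖ < η := by
    intro η hη
    filter_upwards [eventually_gt_atTop 1, hrad.eventually_gt_atTop M,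
      hlim.eventually_lt_const hη] with p hp hM hlt x hx
    have h := (zMinus_estimates F hp).2 M hM x (by simpa using hKM hx)
    exact ⟨h.1.trans_lt hlt, h.2.trans_lt hlt⟩
  rw [Metric.tendstoUniformlyOn_iff, Metric.tendstoUniformlyOn_iff]
  constructor
  · intro η hη
    filter_upwards [hest η hη] with p h x hx
    rw [dist_comm, Real.dist_eq]
    exact (h x hx).1
  · intro η hη
    filter_upwards [hest η hη] with p h x hx
    rw [dist_comm, dist_eq_norm]
    exact (h x hx).2
end
end
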